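/- arXiv:1307.2316 — 9 statements merged into one kernel-verified Lean document; each statement's English description precedes it below -/
import Mathlib

section
/- Let f(x) be a polynomial of degree at least 1 over the rational field ℚ. Suppose f(x) admits two factorizations f(x) = (x^{r_1}-1)^{i_1}(x^{r_2}-1)^{i_2}⋯(x^{r_l}-1)^{i_l} = (x^{t_1}-1)^{j_1}(x^{t_2}-1)^{j_2}⋯(x^{t_h}-1)^{j_h}, where r_1 > r_2 > ⋯ > r_l ≥ 1 and t_1 > t_2 > ⋯ > t_h ≥ 1 are positive integers and all exponents i_1,…,i_l, j_1,…,j_h are positive integers. Then h = l, and r_s = t_s and i_s = j_s for every s = 1,…,l. -/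
open Polynomial

lemma count_roots_X_pow_sub_one {m n : ℕ} (hn : 1 ≤ n) {ζ : ℂ} (hζ : IsPrimitiveRoot ζ m) :
    (X ^ n - 1 : ℂ[X]).roots.count ζ = if m ∣ n then 1 else 0 := by
  have h : (X ^ n - 1 : ℂ[X]).roots = nthRoots n 1 := by simp [nthRoots]
  rw [h, Multiset.count_eq_of_nodup
    (Complex.isPrimitiveRoot_exp n (by omega)).nthRoots_one_nodup]
  simp only [mem_nthRoots (by omega : 0 < n), hζ.pow_eq_one_iff_dvd]

lemma count_roots_prod_X_pow_sub_one {m l : ℕ} {r i : ℕ → ℕ} (hr : ∀ s < l, 1 ≤ r s)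
    {ζ : ℂ} (hζ : IsPrimitiveRoot ζ m) :
    ((∏ s ∈ Finset.range l, (X ^ r s - 1 : ℚ[X]) ^ i s).map (algebraMap ℚ ℂ)).roots.count ζ =
      ∑ s ∈ Finset.range l, if m ∣ r s then i s else 0 := by
  rw [Polynomial.map_prod, roots_prod, Multiset.count_bind, Finset.sum_map_val]
  · refine Finset.sum_congr rfl fun s hs ↦ ?_
    simp [count_roots_X_pow_sub_one (hr s (Finset.mem_range.1 hs)) hζ]
  · refine Finset.prod_ne_zero_iff.2 fun s hs ↦ ?_
    have := hr s (Finset.mem_range.1 hs)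
    simpa using pow_ne_zero (i s) (X_pow_sub_C_ne_zero (by omega : 0 < r s) (1 : ℂ))

lemma lt_head_of_step {l : ℕ} {r : ℕ → ℕ} (hr : ∀ s, s + 1 < l → r (s + 1) < r s) (s : ℕ)
    (hs : s + 1 < l) : r (s + 1) < r 0 := by
  induction s with
  | zero => exact hr 0 hs
  | succ s ih => exact (hr _ hs).trans (ih (by omega))

lemma sum_ite_head_dvd {l : ℕ} {r i : ℕ → ℕ} (hr_pos : ∀ s < l + 1, 1 ≤ r s)
    (hr : ∀ s, s + 1 < l + 1 → r (s + 1) < r s) :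
    (∑ s ∈ Finset.range (l + 1), if r 0 ∣ r s then i s else 0) = i 0 := by
  rw [Finset.sum_range_succ', Finset.sum_eq_zero]
  · simp
  · intro s hs
    have hs' : s + 1 < l + 1 := by simpa using hs
    rw [if_neg (Nat.not_dvd_of_pos_of_lt (hr_pos _ hs') (lt_head_of_step hr s hs'))]

lemma head_le_of_sum_dvd_eq {l h : ℕ} {r i t j : ℕ → ℕ}
    (hr_pos : ∀ s < l + 1, 1 ≤ r s) (hi_pos : ∀ s < l + 1, 1 ≤ i s)
    (ht_pos : ∀ s < h + 1, 1 ≤ t s)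
    (hr : ∀ s, s + 1 < l + 1 → r (s + 1) < r s) (ht : ∀ s, s + 1 < h + 1 → t (s + 1) < t s)
    (H : (∑ s ∈ Finset.range (l + 1), if r 0 ∣ r s then i s else 0) =
      ∑ s ∈ Finset.range (h + 1), if r 0 ∣ t s then j s else 0) : r 0 ≤ t 0 := by
  rw [sum_ite_head_dvd hr_pos hr] at H
  have h0 := hi_pos 0 (by omega)
  obtain ⟨s, hs, hne⟩ := Finset.exists_ne_zero_of_sum_ne_zero (by omega :
    (∑ s ∈ Finset.range (h + 1), if r 0 ∣ t s then j s else 0) ≠ 0)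
  have hs' : s < h + 1 := Finset.mem_range.1 hs
  have hd : r 0 ∣ t s := by
    by_contra hd
    exact hne (if_neg hd)
  refine (Nat.le_of_dvd (ht_pos s hs') hd).trans ?_
  cases s with
  | zero => exact le_rfl
  | succ s => exact (lt_head_of_step ht s hs').le

lemma eq_of_sum_dvd_eq (l h : ℕ) (r i t j : ℕ → ℕ)
    (hr_pos : ∀ s < l, 1 ≤ r s) (hi_pos : ∀ s < l, 1 ≤ i s)
    (ht_pos : ∀ s < h, 1 ≤ t s) (hj_pos : ∀ s < h, 1 ≤ j s)
    (hr : ∀ s, s + 1 < l → r (s + 1) < r s) (ht : ∀ s, s + 1 < h → t (s + 1) < t s)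
    (H : ∀ m, 1 ≤ m → (∑ s ∈ Finset.range l, if m ∣ r s then i s else 0) =
      ∑ s ∈ Finset.range h, if m ∣ t s then j s else 0) :
    h = l ∧ ∀ s < l, r s = t s ∧ i s = j s := by
  induction l generalizing h r i t j with
  | zero =>
    cases h with
    | zero => simp
    | succ h =>
      have h1 := H 1 le_rfl
      have := hj_pos 0 (by omega)
      simp [Finset.sum_range_succ'] at h1
      omega
  | succ l ih =>
    cases h with
    | zero =>
      have h1 := H 1 le_rfl
      have := hi_pos 0 (by omega)
      simp [Finset.sum_range_succ'] at h1
      omega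
    | succ h =>
      have hrt : r 0 = t 0 := le_antisymm
        (head_le_of_sum_dvd_eq hr_pos hi_pos ht_pos hr ht (H _ (hr_pos 0 (by omega))))
        (head_le_of_sum_dvd_eq ht_pos hj_pos hr_pos ht hr (H _ (ht_pos 0 (by omega))).symm)
      have hij : i 0 = j 0 := by
        have := H _ (hr_pos 0 (by omega))
        rwa [sum_ite_head_dvd hr_pos hr, hrt, sum_ite_head_dvd ht_pos ht] at this
      obtain ⟨rfl, htail⟩ := ih h (fun s ↦ r (s + 1)) (fun s ↦ i (s + 1)) (fun s ↦ t (s + 1))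
        (fun s ↦ j (s + 1)) (fun s hs ↦ hr_pos _ (by omega)) (fun s hs ↦ hi_pos _ (by omega))
        (fun s hs ↦ ht_pos _ (by omega)) (fun s hs ↦ hj_pos _ (by omega))
        (fun s hs ↦ hr _ (by omega)) (fun s hs ↦ ht _ (by omega)) (fun m hm ↦ by
          have := H m hm
          rw [Finset.sum_range_succ', Finset.sum_range_succ', hrt, hij] at this
          exact Nat.add_right_cancel this)
      refine ⟨rfl, fun s hs ↦ ?_⟩
      cases s with
      | zero => exact ⟨hrt, hij⟩
      | succ s => exact htail s (by omega)

/-- Lemma 5.7(i): if a polynomial `f` over `ℚ` of degree at least `1` has two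
factorizations into products of terms `(x^r - 1)` with strictly decreasing
positive exponents `r₁ > ⋯ > r_l ≥ 1` and `t₁ > ⋯ > t_h ≥ 1` and positive
multiplicities, then the two factorizations coincide. -/
theorem stmt0 (f : Polynomial ℚ) (hdeg : 1 ≤ f.degree)
    (l h : ℕ) (r i t j : ℕ → ℕ)
    (hr_pos : ∀ s < l, 1 ≤ r s) (hi_pos : ∀ s < l, 1 ≤ i s)
    (ht_pos : ∀ s < h, 1 ≤ t s) (hj_pos : ∀ s < h, 1 ≤ j s)
    (hr_anti : ∀ s, s + 1 < l → r (s + 1) < r s)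
    (ht_anti : ∀ s, s + 1 < h → t (s + 1) < t s)
    (hf1 : f = ∏ s ∈ Finset.range l, (X ^ r s - 1) ^ i s)
    (hf2 : f = ∏ s ∈ Finset.range h, (X ^ t s - 1) ^ j s) :
    h = l ∧ ∀ s < l, r s = t s ∧ i s = j s := by
  refine eq_of_sum_dvd_eq l h r i t j hr_pos hi_pos ht_pos hj_pos hr_anti ht_anti fun m hm ↦ ?_
  have hζ := Complex.isPrimitiveRoot_exp m (by omega)
  rw [← count_roots_prod_X_pow_sub_one hr_pos hζ, ← count_roots_prod_X_pow_sub_one ht_pos hζ,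
    ← hf1, ← hf2]
end

section
/- Let f(x) be a polynomial of degree at least 1 over the rational field ℚ and let r be a positive integer. Suppose f(x) admits two factorizations f(x) = (x^r+1)(x^{r_1}-1)^{i_1}⋯(x^{r_l}-1)^{i_l} = (x^{t_1}-1)^{j_1}⋯(x^{t_h}-1)^{j_h}, where r_1,…,r_l and t_1,…,t_h are positive integers and all exponents i_1,…,i_l, j_1,…,j_h are positive integers. Then there exists an index s ∈ {1,…,h} such that t_s = 2r. -/
open Polynomial

theorem exists_ge_mem_of_prod_X_pow_sub_one_eq {A B : Multiset ℕ} (hA : ∀ a ∈ A, 0 < a)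
    (hB : ∀ b ∈ B, 0 < b)
    (hAB : (A.map fun n => (X ^ n - 1 : ℚ[X])).prod = (B.map fun n => (X ^ n - 1 : ℚ[X])).prod)
    {a : ℕ} (ha : a ∈ A) : ∃ b ∈ B, a ≤ b := by
  have hζ := Complex.isPrimitiveRoot_exp a (hA a ha).ne'
  set ζ := Complex.exp (2 * Real.pi * Complex.I / a)
  have hA0 : aeval ζ (A.map fun n => (X ^ n - 1 : ℚ[X])).prod = 0 := by
    rw [map_multiset_prod, Multiset.prod_eq_zero_iff, Multiset.map_map, Multiset.mem_map]
    exact ⟨a, ha, by simp [hζ.pow_eq_one]⟩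
  rw [hAB, map_multiset_prod, Multiset.prod_eq_zero_iff, Multiset.map_map,
    Multiset.mem_map] at hA0
  obtain ⟨b, hb, hb0⟩ := hA0
  have hpow : ζ ^ b = 1 := by simpa [sub_eq_zero] using hb0
  exact ⟨b, hb, Nat.le_of_dvd (hB b hb) (hζ.dvd_of_pow_eq_one b hpow)⟩

/-- A product of polynomials `X ^ n - 1` with `n` positive determines the multiset of the
exponents `n`. -/
theorem eq_of_prod_X_pow_sub_one_eq {A B : Multiset ℕ} (hA : ∀ a ∈ A, 0 < a)
    (hB : ∀ b ∈ B, 0 < b)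
    (hAB : (A.map fun n => (X ^ n - 1 : ℚ[X])).prod = (B.map fun n => (X ^ n - 1 : ℚ[X])).prod) :
    A = B := by
  induction hc : A.card generalizing A B with
  | zero =>
    obtain rfl := Multiset.card_eq_zero.mp hc
    refine (Multiset.eq_zero_of_forall_notMem fun b hb => ?_).symm
    obtain ⟨a, ha, -⟩ := exists_ge_mem_of_prod_X_pow_sub_one_eq hB hA hAB.symm hb
    exact Multiset.notMem_zero a ha
  | succ k ih =>
    obtain ⟨a, ha⟩ := Multiset.card_pos_iff_exists_mem.mp (hc.symm ▸ k.succ_pos : 0 < A.card)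
    obtain ⟨m, hm, hmax⟩ := A.toFinset.exists_max_image id ⟨a, Multiset.mem_toFinset.mpr ha⟩
    rw [Multiset.mem_toFinset] at hm
    obtain ⟨b, hb, hmb⟩ := exists_ge_mem_of_prod_X_pow_sub_one_eq hA hB hAB hm
    obtain ⟨c, hcA, hbc⟩ := exists_ge_mem_of_prod_X_pow_sub_one_eq hB hA hAB.symm hb
    obtain rfl : b = m :=
      le_antisymm (hbc.trans (hmax c (Multiset.mem_toFinset.mpr hcA))) hmb
    obtain ⟨A, rfl⟩ := Multiset.exists_cons_of_mem hm
    obtain ⟨B, rfl⟩ := Multiset.exists_cons_of_mem hb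
    simp only [Multiset.map_cons, Multiset.prod_cons] at hAB
    have hne : (X ^ b - 1 : ℚ[X]) ≠ 0 := (monic_X_pow_sub_C 1 (hB b hb).ne').ne_zero
    rw [ih (fun a ha => hA a (Multiset.mem_cons_of_mem ha))
      (fun a ha => hB a (Multiset.mem_cons_of_mem ha)) (mul_left_cancel₀ hne hAB)
      (by simpa using hc)]

theorem prod_map_sum_nsmul_singleton {M : Type*} [CommMonoid M] (g : ℕ → M) (n : ℕ)
    (a e : ℕ → ℕ) :
    ((∑ s ∈ Finset.range n, e s • ({a s} : Multiset ℕ)).map g).prod =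
      ∏ s ∈ Finset.range n, g (a s) ^ e s := by
  induction n with
  | zero => simp
  | succ n ih => simp [Finset.sum_range_succ, Finset.prod_range_succ, ih, Multiset.map_nsmul,
      Multiset.prod_nsmul]

theorem exists_eq_of_mem_sum_nsmul_singleton {n : ℕ} {a e : ℕ → ℕ} {x : ℕ}
    (hx : x ∈ ∑ s ∈ Finset.range n, e s • ({a s} : Multiset ℕ)) : ∃ s < n, a s = x := by
  obtain ⟨s, hs, hxs⟩ := Multiset.mem_sum.mp hx
  exact ⟨s, Finset.mem_range.mp hs,
    (Multiset.mem_singleton.mp (Multiset.mem_of_mem_nsmul hxs)).symm⟩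

/-- Lemma 5.7(ii): if a polynomial `f` over `ℚ` of degree at least `1` can be
written both as `(x^r + 1)·(x^{r₁}-1)^{i₁}⋯(x^{r_l}-1)^{i_l}` and as
`(x^{t₁}-1)^{j₁}⋯(x^{t_h}-1)^{j_h}` with all exponents positive integers, then
some `t_s` equals `2r`. -/
theorem stmt1 (f : Polynomial ℚ) (hdeg : 1 ≤ f.degree)
    (r : ℕ) (hr : 1 ≤ r)
    (l h : ℕ) (r' i t j : ℕ → ℕ)
    (hr'_pos : ∀ s < l, 1 ≤ r' s) (hi_pos : ∀ s < l, 1 ≤ i s)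
    (ht_pos : ∀ s < h, 1 ≤ t s) (hj_pos : ∀ s < h, 1 ≤ j s)
    (hf1 : f = (X ^ r + 1) * ∏ s ∈ Finset.range l, (X ^ r' s - 1) ^ i s)
    (hf2 : f = ∏ s ∈ Finset.range h, (X ^ t s - 1) ^ j s) :
    ∃ s < h, t s = 2 * r := by
  have key : (2 * r) ::ₘ ∑ s ∈ Finset.range l, i s • ({r' s} : Multiset ℕ) =
      r ::ₘ ∑ s ∈ Finset.range h, j s • ({t s} : Multiset ℕ) := by
    refine eq_of_prod_X_pow_sub_one_eq (fun a ha => ?_) (fun a ha => ?_) ?_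
    · rcases Multiset.mem_cons.mp ha with rfl | ha
      · omega
      · obtain ⟨s, hs, rfl⟩ := exists_eq_of_mem_sum_nsmul_singleton ha
        exact hr'_pos s hs
    · rcases Multiset.mem_cons.mp ha with rfl | ha
      · exact hr
      · obtain ⟨s, hs, rfl⟩ := exists_eq_of_mem_sum_nsmul_singleton ha
        exact ht_pos s hs
    · simp only [Multiset.map_cons, Multiset.prod_cons, prod_map_sum_nsmul_singleton]
      rw [← hf2, hf1]
      ring
  have hmem : 2 * r ∈ r ::ₘ ∑ s ∈ Finset.range h, j s • ({t s} : Multiset ℕ) :=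
    key ▸ Multiset.mem_cons_self _ _
  rcases Multiset.mem_cons.mp hmem with h2 | hmem
  · omega
  · exact exists_eq_of_mem_sum_nsmul_singleton hmem
end

section
/- Let f(x) be a polynomial of degree at least 1 over the rational field ℚ. Suppose f(x) admits two factorizations f(x) = (x^{k_1}+1)⋯(x^{k_f}+1)(x^{r_1}-1)^{i_1}⋯(x^{r_l}-1)^{i_l} = (x^{t_1}-1)^{j_1}⋯(x^{t_h}-1)^{j_h}, where k_1,…,k_f are pairwise distinct odd positive integers, r_1,…,r_l and t_1,…,t_h are positive integers, and all exponents i_1,…,i_l, j_1,…,j_h are positive integers. Then there exist indices s_1,…,s_f ∈ {1,…,h} such that t_{s_1} = 2k_1, …, t_{s_f} = 2k_f. -/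
open Polynomial

/-- If every exponent in `N` is positive and at most `m`, and `X ^ m - 1` divides the product of the
`X ^ n - 1` for `n` in `N`, then `m` occurs in `N`. -/
theorem mem_of_X_pow_sub_one_dvd_prod {N : Multiset ℕ} {m : ℕ} (hm : 0 < m)
    (hN : ∀ n ∈ N, 0 < n ∧ n ≤ m)
    (hdvd : (X ^ m - 1 : ℚ[X]) ∣ (N.map fun n => (X ^ n - 1 : ℚ[X])).prod) : m ∈ N := by
  have hirr : Prime (cyclotomic m ℚ) := (cyclotomic.irreducible_rat hm).prime
  obtain ⟨n, hn, hmn⟩ := hirr.exists_mem_multiset_map_dvd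
    ((cyclotomic.dvd_X_pow_sub_one m ℚ).trans hdvd)
  obtain ⟨hpos, hle⟩ := hN n hn
  have hroot : (X ^ n - 1 : ℂ[X]).IsRoot (Complex.exp (2 * Real.pi * Complex.I / m)) := by
    have hprim := Complex.isPrimitiveRoot_exp m hm.ne'
    have hd := map_dvd (mapRingHom (algebraMap ℚ ℂ)) hmn
    simp only [coe_mapRingHom, map_cyclotomic, Polynomial.map_sub, Polynomial.map_pow,
      map_X, Polynomial.map_one] at hd
    exact (hprim.isRoot_cyclotomic hm).dvd hd
  have hdiv : m ∣ n := by
    apply (Complex.isPrimitiveRoot_exp m hm.ne').dvd_of_pow_eq_one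
    simpa [IsRoot.def, sub_eq_zero] using hroot
  rwa [le_antisymm (Nat.le_of_dvd hpos hdiv) hle]

/-- The polynomials `X ^ n - 1` with `n` positive are multiplicatively independent. -/
theorem multiset_eq_of_prod_X_pow_sub_one_eq (M N : Multiset ℕ)
    (hM : ∀ n ∈ M, 0 < n) (hN : ∀ n ∈ N, 0 < n)
    (h : (M.map fun n => (X ^ n - 1 : ℚ[X])).prod = (N.map fun n => (X ^ n - 1 : ℚ[X])).prod) :
    M = N := by
  induction hc : M.card generalizing M N with
  | zero =>
    obtain rfl := Multiset.card_eq_zero.1 hc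
    refine (Multiset.eq_zero_of_forall_notMem fun n hn => ?_).symm
    have hdvd := Multiset.dvd_prod (Multiset.mem_map_of_mem (fun n => (X ^ n - 1 : ℚ[X])) hn)
    rw [← h] at hdvd
    have hunit := natDegree_eq_zero_of_isUnit (isUnit_of_dvd_one (by simpa using hdvd))
    rw [← C_1, natDegree_X_pow_sub_C] at hunit
    exact (hN n hn).ne' hunit
  | succ c ih =>
    obtain ⟨m, hmM, hmN⟩ : ∃ m, m ∈ M ∧ m ∈ N := by
      obtain ⟨a, ha⟩ := Multiset.card_pos_iff_exists_mem.1 (by omega : 0 < M.card)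
      obtain ⟨m, hm, hmax⟩ := (M + N).toFinset.exists_max_image id ⟨a, by simp [ha]⟩
      simp only [Multiset.mem_toFinset, Multiset.mem_add, id] at hm hmax
      rcases hm with hm | hm
      · refine ⟨m, hm, mem_of_X_pow_sub_one_dvd_prod (hM m hm)
          (fun n hn => ⟨hN n hn, hmax n (.inr hn)⟩) ?_⟩
        rw [← h]
        exact Multiset.dvd_prod (Multiset.mem_map_of_mem (fun n => (X ^ n - 1 : ℚ[X])) hm)
      · refine ⟨m, mem_of_X_pow_sub_one_dvd_prod (hN m hm)
          (fun n hn => ⟨hM n hn, hmax n (.inl hn)⟩) ?_, hm⟩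
        rw [h]
        exact Multiset.dvd_prod (Multiset.mem_map_of_mem (fun n => (X ^ n - 1 : ℚ[X])) hm)
    obtain ⟨M', rfl⟩ := Multiset.exists_cons_of_mem hmM
    obtain ⟨N', rfl⟩ := Multiset.exists_cons_of_mem hmN
    have hne : (X ^ m - 1 : ℚ[X]) ≠ 0 := by
      rw [← C_1]
      exact X_pow_sub_C_ne_zero (hM m hmM) 1
    rw [Multiset.map_cons, Multiset.map_cons, Multiset.prod_cons, Multiset.prod_cons] at h
    rw [ih M' N' (fun n hn => hM n (Multiset.mem_cons_of_mem hn))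
      (fun n hn => hN n (Multiset.mem_cons_of_mem hn)) (mul_left_cancel₀ hne h)
      (by simpa using hc)]

/-- A product of powers of polynomials `X ^ r s - 1`, as a product over the multiset of exponents. -/
theorem prod_map_bind_replicate_X_pow_sub_one (l : ℕ) (r i : ℕ → ℕ) :
    ((((Finset.range l).val.bind fun s => Multiset.replicate (i s) (r s))).map
      fun n => (X ^ n - 1 : ℚ[X])).prod = ∏ s ∈ Finset.range l, (X ^ r s - 1) ^ i s := by
  simp [Multiset.map_bind, Multiset.prod_bind, Finset.prod]

/-- Lemma 5.7(iii): if a polynomial `F` over `ℚ` of degree at least `1` can be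
written both as `(x^{k₁}+1)⋯(x^{k_f}+1)·(x^{r₁}-1)^{i₁}⋯(x^{r_l}-1)^{i_l}`,
where `k₁,…,k_f` are pairwise distinct odd positive integers, and as
`(x^{t₁}-1)^{j₁}⋯(x^{t_h}-1)^{j_h}`, then for every `k_s` some `t_{s'}` equals
`2k_s`. -/
theorem stmt2 (F : Polynomial ℚ) (hdeg : 1 ≤ F.degree)
    (fk l h : ℕ) (k r i t j : ℕ → ℕ)
    (hk_pos : ∀ s < fk, 1 ≤ k s) (hk_odd : ∀ s < fk, Odd (k s))
    (hk_dist : ∀ s₁ < fk, ∀ s₂ < fk, s₁ ≠ s₂ → k s₁ ≠ k s₂)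
    (hr_pos : ∀ s < l, 1 ≤ r s) (hi_pos : ∀ s < l, 1 ≤ i s)
    (ht_pos : ∀ s < h, 1 ≤ t s) (hj_pos : ∀ s < h, 1 ≤ j s)
    (hf1 : F = (∏ s ∈ Finset.range fk, (X ^ k s + 1)) *
        ∏ s ∈ Finset.range l, (X ^ r s - 1) ^ i s)
    (hf2 : F = ∏ s ∈ Finset.range h, (X ^ t s - 1) ^ j s) :
    ∀ s < fk, ∃ s' < h, t s' = 2 * k s := by
  intro s hs
  let A := (Finset.range fk).val.map (fun s => 2 * k s) +
    (Finset.range l).val.bind fun s => Multiset.replicate (i s) (r s)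
  let B := (Finset.range h).val.bind (fun s => Multiset.replicate (j s) (t s)) +
    (Finset.range fk).val.map k
  have hA : ∀ n ∈ A, 0 < n := by
    intro n hn
    simp only [A, Multiset.mem_add, Multiset.mem_map, Multiset.mem_bind, Finset.mem_val,
      Finset.mem_range] at hn
    rcases hn with ⟨s, hs, rfl⟩ | ⟨s, hs, hn⟩
    · have := hk_pos s hs
      omega
    · rw [Multiset.eq_of_mem_replicate hn]
      exact hr_pos s hs
  have hB : ∀ n ∈ B, 0 < n := by
    intro n hn
    simp only [B, Multiset.mem_add, Multiset.mem_map, Multiset.mem_bind, Finset.mem_val,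
      Finset.mem_range] at hn
    rcases hn with ⟨s, hs, hn⟩ | ⟨s, hs, rfl⟩
    · rw [Multiset.eq_of_mem_replicate hn]
      exact ht_pos s hs
    · exact hk_pos s hs
  have hfactor : ∏ s ∈ Finset.range fk, (X ^ (2 * k s) - 1 : ℚ[X]) =
      (∏ s ∈ Finset.range fk, (X ^ k s + 1)) * ∏ s ∈ Finset.range fk, (X ^ k s - 1) := by
    rw [← Finset.prod_mul_distrib]
    exact Finset.prod_congr rfl fun s _ => by ring
  have hAB : A = B := by
    refine multiset_eq_of_prod_X_pow_sub_one_eq A B hA hB ?_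
    simp only [A, B, Multiset.map_add, Multiset.prod_add, prod_map_bind_replicate_X_pow_sub_one,
      Multiset.map_map, Function.comp_def]
    change (∏ s ∈ Finset.range fk, (X ^ (2 * k s) - 1 : ℚ[X])) * _ =
      _ * ∏ s ∈ Finset.range fk, (X ^ k s - 1 : ℚ[X])
    rw [hfactor, ← hf2, hf1]
    ring
  have hmem : 2 * k s ∈ B := by
    rw [← hAB]
    exact Multiset.mem_add.2 (.inl (Multiset.mem_map.2 ⟨s, by simpa using hs, rfl⟩))
  simp only [B, Multiset.mem_add, Multiset.mem_map, Multiset.mem_bind, Finset.mem_val,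
    Finset.mem_range] at hmem
  rcases hmem with ⟨s', hs', hn⟩ | ⟨s', hs', hn⟩
  · exact ⟨s', hs', (Multiset.eq_of_mem_replicate hn).symm⟩
  · obtain ⟨c, hc⟩ := hk_odd s' hs'
    omega
end

section
/- Let D be a division ring, let V be a left vector space over D of finite dimension n, and let t be an integer with n ≥ 2t ≥ 4. Let S, U, T be subspaces of V, each of dimension n−t, such that S + U = V, and such that dim(S ∩ T) > n − 2t or dim(U ∩ T) > n − 2t. Then there exists a subspace Q of V of dimension n−t such that S + Q = V, U + Q = V, and T + Q = V. -/
namespace Submodule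

section Module

variable {R M : Type*} [Ring R] [AddCommGroup M] [Module R M]

theorem exists_mem_notMem_notMem {H A B : Submodule R M} (hA : ¬H ≤ A) (hB : ¬H ≤ B) :
    ∃ x ∈ H, x ∉ A ∧ x ∉ B := by
  obtain ⟨a, haH, haA⟩ := SetLike.not_le_iff_exists.1 hA
  obtain ⟨b, hbH, hbB⟩ := SetLike.not_le_iff_exists.1 hB
  by_cases haB : a ∈ B
  · by_cases hbA : b ∈ A
    · exact ⟨a + b, H.add_mem haH hbH, fun h => haA ((A.add_mem_iff_left hbA).1 h),
        fun h => hbB ((B.add_mem_iff_right haB).1 h)⟩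
    · exact ⟨b, hbH, hbA, hbB⟩
  · exact ⟨a, haH, haA, haB⟩

theorem exists_mem_notMem_notMem_notMem {H A B C : Submodule R M} (hA : ¬H ≤ A) (hB : ¬H ≤ B)
    (hC : ∀ x, ¬H ≤ C ⊔ span R {x}) : ∃ x ∈ H, x ∉ A ∧ x ∉ B ∧ x ∉ C := by
  have hC' : ¬H ≤ C := fun h => hC 0 (h.trans le_sup_left)
  by_contra! hcon
  have key : ∀ z ∈ H, z ∉ A → z ∉ C → z ∈ B := fun z hz hzA hzC => by
    by_contra hzB
    exact hzC (hcon z hz hzA hzB)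
  obtain ⟨y, hyH, hyB, hyC⟩ := exists_mem_notMem_notMem hB hC'
  have hyA : y ∈ A := by
    by_contra hyA
    exact hyC (hcon y hyH hyA hyB)
  obtain ⟨x, hxH, hxA, hxC⟩ := exists_mem_notMem_notMem hA hC'
  have hadd : ∀ z ∈ H, z ∉ A → z ∉ C → z + y ∈ C := fun z hz hzA hzC =>
    hcon _ (H.add_mem hz hyH) (fun h => hzA ((A.add_mem_iff_left hyA).1 h))
      (fun h => hyB ((B.add_mem_iff_right (key z hz hzA hzC)).1 h))
  obtain ⟨z, hzH, hzA, hzK⟩ := exists_mem_notMem_notMem hA (hC x)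
  refine hzK ?_
  have hsub : z - x ∈ C := by
    simpa using C.sub_mem (hadd z hzH hzA fun h => hzK (mem_sup_left h)) (hadd x hxH hxA hxC)
  simpa using add_mem (mem_sup_left hsub : z - x ∈ C ⊔ span R {x})
    (mem_sup_right (mem_span_singleton_self x))

end Module

section DivisionRing

open Module

variable {K V : Type*} [DivisionRing K] [AddCommGroup V] [Module K V] [FiniteDimensional K V]

theorem exists_between_finrank_eq {A B : Submodule K V} (hAB : A ≤ B) {k : ℕ}
    (hA : finrank K A ≤ k) (hB : k ≤ finrank K B) :
    ∃ C : Submodule K V, A ≤ C ∧ C ≤ B ∧ finrank K C = k := by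
  induction k, hA using Nat.le_induction with
  | base => exact ⟨A, le_rfl, hAB, rfl⟩
  | succ k _ ih =>
    obtain ⟨C, hAC, hCB, hC⟩ := ih (by omega)
    obtain ⟨x, hxB, hxC⟩ := SetLike.not_le_iff_exists.1 fun h : B ≤ C => by
      have := finrank_mono h
      omega
    refine ⟨C ⊔ span K {x}, hAC.trans le_sup_left, sup_le hCB (by simpa using hxB), ?_⟩
    rw [finrank_sup_span_singleton hxC, hC]

/-- Three subspaces of the same positive codimension have a common complement if two of them lie
in a hyperplane which does not contain the third. -/
theorem exists_finrank_eq_disjoint_of_le_hyperplane {H : Submodule K V}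
    (hH : finrank K H + 1 = finrank K V) (k : ℕ) {S T U : Submodule K V}
    (hS : finrank K S + (k + 1) = finrank K V) (hT : finrank K T + (k + 1) = finrank K V)
    (hU : finrank K U + (k + 1) = finrank K V) (hSH : S ≤ H) (hTH : T ≤ H) (hUH : ¬U ≤ H) :
    ∃ W : Submodule K V,
      finrank K W = k + 1 ∧ Disjoint S W ∧ Disjoint T W ∧ Disjoint U W := by
  induction k generalizing S T U with
  | zero =>
    have not_top_le {A : Submodule K V} (hA : finrank K A + 1 = finrank K V) : ¬⊤ ≤ A := by
      intro h
      have := finrank_mono h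
      rw [finrank_top] at this
      omega
    obtain ⟨w, -, hwH, hwU⟩ := exists_mem_notMem_notMem (not_top_le hH) (not_top_le hU)
    exact ⟨span K {w}, finrank_span_singleton fun h => hwH (h ▸ H.zero_mem),
      disjoint_span_singleton_of_notMem fun h => hwH (hSH h),
      disjoint_span_singleton_of_notMem fun h => hwH (hTH h),
      disjoint_span_singleton_of_notMem hwU⟩
  | succ k ih =>
    have not_le {A : Submodule K V} (hA : finrank K A + (k + 1 + 1) = finrank K V) : ¬H ≤ A := by
      intro h
      have := finrank_mono h
      omega
    have not_le_sup (x : V) : ¬H ≤ U ⊔ span K {x} := by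
      intro h
      have hle : finrank K ↥(U ⊔ span K {x}) ≤ finrank K H := by
        by_cases hx : x ∈ U
        · rw [sup_eq_left.2 (by simpa using hx)]
          omega
        · rw [finrank_sup_span_singleton hx]
          omega
      exact hUH (eq_of_le_of_finrank_le h hle ▸ le_sup_left)
    obtain ⟨w, hwH, hwS, hwT, hwU⟩ :=
      exists_mem_notMem_notMem_notMem (not_le hS) (not_le hT) not_le_sup
    have hw : span K {w} ≤ H := by simpa using hwH
    obtain ⟨W, hW, hSW, hTW, hUW⟩ := ih (S := S ⊔ span K {w}) (T := T ⊔ span K {w})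
      (U := U ⊔ span K {w}) (by rw [finrank_sup_span_singleton hwS]; omega)
      (by rw [finrank_sup_span_singleton hwT]; omega)
      (by rw [finrank_sup_span_singleton hwU]; omega)
      (sup_le hSH hw) (sup_le hTH hw) fun h => hUH (le_sup_left.trans h)
    have disjoint_sup {A : Submodule K V} (hwA : w ∉ A) (hA : Disjoint (A ⊔ span K {w}) W) :
        Disjoint A (W ⊔ span K {w}) := by
      rw [sup_comm]
      exact (disjoint_span_singleton_of_notMem hwA).disjoint_sup_right_of_disjoint_sup_left hA
    refine ⟨W ⊔ span K {w}, ?_, disjoint_sup hwS hSW, disjoint_sup hwT hTW, disjoint_sup hwU hUW⟩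
    rw [finrank_sup_span_singleton, hW]
    exact fun h => hwS <| by
      have := disjoint_def.1 hSW w (mem_sup_right (mem_span_singleton_self w)) h
      simp [this]

theorem exists_finrank_eq_disjoint_of_sup_ne_top {S T U : Submodule K V} {t : ℕ} (ht : t ≠ 0)
    (hS : finrank K S + t = finrank K V) (hT : finrank K T + t = finrank K V)
    (hU : finrank K U + t = finrank K V) (hST : S ⊔ T ≠ ⊤) (hSU : S ⊔ U = ⊤) :
    ∃ W : Submodule K V, finrank K W = t ∧ Disjoint S W ∧ Disjoint T W ∧ Disjoint U W := by
  obtain ⟨k, rfl⟩ := Nat.exists_eq_succ_of_ne_zero ht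
  have hlt := finrank_lt hST
  obtain ⟨H, hSTH, -, hH⟩ := exists_between_finrank_eq (le_top : S ⊔ T ≤ ⊤)
    (k := finrank K V - 1) (by omega) (by rw [finrank_top]; omega)
  have hSH := le_sup_left.trans hSTH
  refine exists_finrank_eq_disjoint_of_le_hyperplane (H := H) (by omega) k hS hT hU hSH
    (le_sup_right.trans hSTH) fun hUH => ?_
  have htop : H = ⊤ := top_le_iff.1 (hSU ▸ sup_le hSH hUH)
  rw [htop, finrank_top] at hH
  omega

end DivisionRing

end Submodule


/-- Lemma 2.1 (linear-algebra form): let `V` be an `n`-dimensional vector space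
over a division ring with `n ≥ 2t ≥ 4`, and let `S`, `U`, `T` be subspaces of
dimension `n - t` such that `S + U = V` and `dim(S ∩ T) > n - 2t` or
`dim(U ∩ T) > n - 2t`. Then there is an `(n-t)`-dimensional subspace `Q` with
`S + Q = U + Q = T + Q = V`. -/
theorem stmt3 (D : Type*) [DivisionRing D] (V : Type*) [AddCommGroup V] [Module D V]
    [FiniteDimensional D V] (n t : ℕ) (ht : 4 ≤ 2 * t) (hn : 2 * t ≤ n)
    (hV : Module.finrank D V = n)
    (S U T : Submodule D V)
    (hS : Module.finrank D S = n - t)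
    (hU : Module.finrank D U = n - t)
    (hT : Module.finrank D T = n - t)
    (hSU : S ⊔ U = ⊤)
    (hmeet : n - 2 * t < Module.finrank D ↥(S ⊓ T) ∨
      n - 2 * t < Module.finrank D ↥(U ⊓ T)) :
    ∃ Q : Submodule D V, Module.finrank D Q = n - t ∧
      S ⊔ Q = ⊤ ∧ U ⊔ Q = ⊤ ∧ T ⊔ Q = ⊤ := by
  have sup_ne_top {A B : Submodule D V} (hA : Module.finrank D A = n - t)
      (hB : Module.finrank D B = n - t) (h : n - 2 * t < Module.finrank D ↥(A ⊓ B)) :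
      A ⊔ B ≠ ⊤ := by
    intro htop
    have := Submodule.finrank_sup_add_finrank_inf_eq A B
    rw [htop, finrank_top] at this
    omega
  obtain ⟨W, hW, hSW, hTW, hUW⟩ : ∃ W : Submodule D V,
      Module.finrank D W = t ∧ Disjoint S W ∧ Disjoint T W ∧ Disjoint U W := by
    rcases hmeet with h | h
    · exact Submodule.exists_finrank_eq_disjoint_of_sup_ne_top (by omega) (by omega) (by omega)
        (by omega) (sup_ne_top hS hT h) hSU
    · obtain ⟨W, hW, hUW, hTW, hSW⟩ := Submodule.exists_finrank_eq_disjoint_of_sup_ne_top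
        (t := t) (by omega) (by omega) (by omega) (by omega) (sup_ne_top hU hT h)
        (sup_comm S U ▸ hSU)
      exact ⟨W, hW, hSW, hTW, hUW⟩
  obtain ⟨Q, hWQ, -, hQ⟩ := Submodule.exists_between_finrank_eq (le_top : W ≤ ⊤) (k := n - t)
    (by omega) (by rw [finrank_top]; omega)
  have sup_eq_top {A : Submodule D V} (hA : Module.finrank D A = n - t) (hAW : Disjoint A W) :
      A ⊔ Q = ⊤ :=
    top_le_iff.1 <| (Submodule.eq_top_of_disjoint A W (by omega) hAW).ge.trans
      (sup_le_sup_left hWQ A)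
  exact ⟨Q, hQ, sup_eq_top hS hSW, sup_eq_top hU hUW, sup_eq_top hT hTW⟩
end

section
/- Let D be a division ring, let V be a left vector space over D of finite dimension n, and let t be an integer with n ≥ 2t ≥ 4. Let S, U, T be subspaces of V, each of dimension n−t, such that S + U = V, (S ∩ U) ∩ T = 0, and T = (S ∩ T) + (U ∩ T). Then there exists a subspace Q of V of dimension n−t such that S + Q = V, U + Q = V, and T + Q = V. -/
/-- If `dim M = dim W` and `dim W ≤ dim A + dim B`, some isomorphism `M ≃ W` carries `A` to a
subspace which together with `B` spans `W`. -/
theorem exists_linearEquiv_map_sup_eq_top {D M W : Type*} [DivisionRing D]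
    [AddCommGroup M] [Module D M] [FiniteDimensional D M]
    [AddCommGroup W] [Module D W] [FiniteDimensional D W]
    (h : Module.finrank D M = Module.finrank D W) (A : Submodule D M) (B : Submodule D W)
    (hAB : Module.finrank D W ≤ Module.finrank D A + Module.finrank D B) :
    ∃ e : M ≃ₗ[D] W, A.map (e : M →ₗ[D] W) ⊔ B = ⊤ := by
  obtain ⟨C, hC⟩ := exists_isCompl B
  have hBC := Submodule.finrank_add_eq_of_isCompl hC
  obtain ⟨A₁, hA₁, hd⟩ : ∃ A₁ ≤ A, Module.finrank D A₁ = Module.finrank D C := by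
    obtain ⟨f, hf⟩ := (finrank_le_iff_exists_linearMap (R := D) (M := C) (M' := A)).mp (by omega)
    refine ⟨LinearMap.range (A.subtype ∘ₗ f), ?_,
      LinearMap.finrank_range_of_inj (A.injective_subtype.comp hf)⟩
    rintro _ ⟨x, rfl⟩
    exact (f x).2
  obtain ⟨A₂, hA₂⟩ := exists_isCompl A₁
  have hA := Submodule.finrank_add_eq_of_isCompl hA₂
  let e₁ : A₁ ≃ₗ[D] C := LinearEquiv.ofFinrankEq _ _ hd
  let e₂ : A₂ ≃ₗ[D] B := LinearEquiv.ofFinrankEq _ _ (by omega)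
  let e : M ≃ₗ[D] W := (Submodule.prodEquivOfIsCompl A₁ A₂ hA₂).symm ≪≫ₗ
    (e₁.prodCongr e₂) ≪≫ₗ Submodule.prodEquivOfIsCompl C B hC.symm
  refine ⟨e, top_le_iff.mp ?_⟩
  rw [← hC.symm.sup_eq_top]
  refine sup_le_sup_right (fun w hw => ?_) _
  refine ⟨e₁.symm ⟨w, hw⟩, hA₁ (e₁.symm ⟨w, hw⟩).2, ?_⟩
  simp [e]

/-- First case in the proof of Lemma 2.1: let `V` be an `n`-dimensional vector
space over a division ring with `n ≥ 2t ≥ 4`, and let `S`, `U`, `T` be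
subspaces of dimension `n - t` such that `S + U = V`, `(S ∩ U) ∩ T = 0` and
`T = (S ∩ T) + (U ∩ T)`. Then there is an `(n-t)`-dimensional subspace `Q`
with `S + Q = U + Q = T + Q = V`. -/
theorem stmt4 (D : Type*) [DivisionRing D] (V : Type*) [AddCommGroup V] [Module D V]
    [FiniteDimensional D V] (n t : ℕ) (ht : 4 ≤ 2 * t) (hn : 2 * t ≤ n)
    (hV : Module.finrank D V = n)
    (S U T : Submodule D V)
    (hS : Module.finrank D S = n - t)
    (hU : Module.finrank D U = n - t)
    (hT : Module.finrank D T = n - t)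
    (hSU : S ⊔ U = ⊤)
    (hNT : (S ⊓ U) ⊓ T = ⊥)
    (hTspan : T = (S ⊓ T) ⊔ (U ⊓ T)) :
    ∃ Q : Submodule D V, Module.finrank D Q = n - t ∧
      S ⊔ Q = ⊤ ∧ U ⊔ Q = ⊤ ∧ T ⊔ Q = ⊤ := by
  obtain ⟨C, hTC, hC⟩ : ∃ C, T ≤ C ∧ IsCompl (S ⊓ U) C := by
    obtain ⟨C, hC, h⟩ := (disjoint_iff.mpr hNT).symm.exists_isCompl
    exact ⟨C, hC, h.symm⟩
  have hS' : (S ⊓ U) ⊔ (C ⊓ S) = S := by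
    rw [← sup_inf_assoc_of_le C (inf_le_left : S ⊓ U ≤ S), hC.sup_eq_top, top_inf_eq]
  have hU' : (S ⊓ U) ⊔ (C ⊓ U) = U := by
    rw [← sup_inf_assoc_of_le C (inf_le_right : S ⊓ U ≤ U), hC.sup_eq_top, top_inf_eq]
  have dSU := Submodule.finrank_sup_add_finrank_inf_eq S U
  rw [hSU, finrank_top] at dSU
  have dS := Submodule.finrank_sup_add_finrank_inf_eq (S ⊓ U) (C ⊓ S)
  have dU := Submodule.finrank_sup_add_finrank_inf_eq (S ⊓ U) (C ⊓ U)
  rw [hS', show (S ⊓ U) ⊓ (C ⊓ S) = ⊥ from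
    (hC.disjoint.mono_right inf_le_left).eq_bot, finrank_bot] at dS
  rw [hU', show (S ⊓ U) ⊓ (C ⊓ U) = ⊥ from
    (hC.disjoint.mono_right inf_le_left).eq_bot, finrank_bot] at dU
  have dT := Submodule.finrank_add_le_finrank_add_finrank (S ⊓ T) (U ⊓ T)
  rw [← hTspan] at dT
  have hA : S ⊓ T ≤ C ⊓ S := le_inf (inf_le_right.trans hTC) inf_le_left
  have hB : U ⊓ T ≤ C ⊓ U := le_inf (inf_le_right.trans hTC) inf_le_left
  obtain ⟨e, he⟩ := exists_linearEquiv_map_sup_eq_top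
    (show Module.finrank D ↥(C ⊓ S) = Module.finrank D ↥(C ⊓ U) by omega)
    ((S ⊓ T).comap (C ⊓ S).subtype) ((U ⊓ T).comap (C ⊓ U).subtype) (by
      rw [(Submodule.comapSubtypeEquivOfLe hA).finrank_eq,
        (Submodule.comapSubtypeEquivOfLe hB).finrank_eq]
      omega)
  let L : ↥(C ⊓ S) →ₗ[D] V := (C ⊓ S).subtype + (C ⊓ U).subtype ∘ₗ (e : _ →ₗ[D] _)
  let Q : Submodule D V := (S ⊓ U) ⊔ LinearMap.range L
  have hLQ (x : ↥(C ⊓ S)) : (x : V) + e x ∈ Q := Submodule.mem_sup_right ⟨x, rfl⟩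
  have top_of (P : Submodule D V) (hQ : Q ≤ P) (h₁ : C ⊓ S ≤ P) (h₂ : C ⊓ U ≤ P) : P = ⊤ := by
    have hN : S ⊓ U ≤ P := le_sup_left.trans hQ
    rw [← top_le_iff, ← hSU]
    exact sup_le (hS' ▸ sup_le hN h₁) (hU' ▸ sup_le hN h₂)
  have top_of_left (P : Submodule D V) (hQ : Q ≤ P) (h₁ : C ⊓ S ≤ P) : P = ⊤ := by
    refine top_of P hQ h₁ fun y hy => ?_
    have h := P.sub_mem (hQ (hLQ (e.symm ⟨y, hy⟩))) (h₁ (e.symm ⟨y, hy⟩).2)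
    simpa using h
  have top_of_right (P : Submodule D V) (hQ : Q ≤ P) (h₂ : C ⊓ U ≤ P) : P = ⊤ := by
    refine top_of P hQ (fun x hx => ?_) h₂
    have h := P.sub_mem (hQ (hLQ ⟨x, hx⟩)) (h₂ (e ⟨x, hx⟩).2)
    simpa using h
  refine ⟨Q, ?_, top_of_left _ le_sup_right (inf_le_right.trans le_sup_left),
    top_of_right _ le_sup_right (inf_le_right.trans le_sup_left),
    top_of_right _ le_sup_right ?_⟩
  · have h₁ := Submodule.finrank_add_le_finrank_add_finrank (S ⊓ U) (LinearMap.range L)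
    have h₂ := LinearMap.finrank_range_le L
    have h₃ := Submodule.finrank_add_le_finrank_add_finrank (C ⊓ S) Q
    rw [top_of_left (C ⊓ S ⊔ Q) le_sup_right le_sup_left, finrank_top] at h₃
    change Module.finrank D Q ≤ _ at h₁
    omega
  · have key : (⊤ : Submodule D ↥(C ⊓ U)) ≤ (T ⊔ Q).comap (C ⊓ U).subtype := by
      rw [← he]
      refine sup_le ?_ (Submodule.comap_mono (inf_le_right.trans le_sup_left))
      rintro _ ⟨x, hx, rfl⟩
      have h := (T ⊔ Q).sub_mem (Submodule.mem_sup_right (hLQ x)) (Submodule.mem_sup_left hx.2)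
      simpa using h
    exact fun y hy => key (x := ⟨y, hy⟩) trivial
end

section
/- Let D be a division ring, let V be a left vector space over D of finite dimension n, and let t be an integer with n ≥ 2t ≥ 4. Let S, U, T be subspaces of V, each of dimension n−t, such that S + U = V, (S ∩ U) ∩ T = 0, dim(S ∩ T) > n − 2t, and dim(S ∩ T) + dim(U ∩ T) < n − t. Then there exists a subspace Q of V of dimension n−t such that S + Q = V, U + Q = V, and T + Q = V. -/
open Module

section Avoidance

variable {D V : Type*} [DivisionRing D] [AddCommGroup V] [Module D V]

theorem exists_notMem_notMem_of_ne_top {A B : Submodule D V} (hA : A ≠ ⊤) (hB : B ≠ ⊤) :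
    ∃ v, v ∉ A ∧ v ∉ B := by
  obtain ⟨x, hx⟩ := SetLike.exists_not_mem_of_ne_top A hA rfl
  obtain ⟨y, hy⟩ := SetLike.exists_not_mem_of_ne_top B hB rfl
  by_cases hxB : x ∈ B
  · by_cases hyA : y ∈ A
    · exact ⟨x + y, fun h => hx ((A.add_mem_iff_left hyA).1 h),
        fun h => hy ((B.add_mem_iff_right hxB).1 h)⟩
    · exact ⟨y, hyA, hy⟩
  · exact ⟨x, hx, hxB⟩

theorem Submodule.disjoint_sup_span_singleton {A W : Submodule D V} {v : V}
    (hAW : Disjoint A W) (hv : v ∉ A ⊔ W) : Disjoint A (W ⊔ (D ∙ v)) :=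
  hAW.disjoint_sup_right_of_disjoint_sup_left (Submodule.disjoint_span_singleton_of_notMem hv)

variable [FiniteDimensional D V]

theorem Submodule.finrank_add_one_of_isCoatom {H : Submodule D V} (hH : IsCoatom H) :
    finrank D H + 1 = finrank D V := by
  obtain ⟨v, hv⟩ := SetLike.exists_not_mem_of_ne_top H hH.1 rfl
  have htop : H ⊔ (D ∙ v) = ⊤ := hH.2 _ <| left_lt_sup.2 <| by
    rwa [Submodule.span_singleton_le_iff_mem]
  rw [← Submodule.finrank_sup_span_singleton hv, htop, finrank_top]

theorem Submodule.exists_le_finrank_eq {W : Submodule D V} {m : ℕ} (hWm : finrank D W ≤ m)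
    (hm : m ≤ finrank D V) : ∃ Q, W ≤ Q ∧ finrank D Q = m := by
  induction m, hWm using Nat.le_induction with
  | base => exact ⟨W, le_rfl, rfl⟩
  | succ m _ ih =>
    obtain ⟨Q, hWQ, hQ⟩ := ih (by omega)
    have hne : Q ≠ ⊤ := fun h => by
      rw [h, finrank_top] at hQ
      omega
    obtain ⟨v, hv⟩ := SetLike.exists_not_mem_of_ne_top Q hne rfl
    exact ⟨Q ⊔ (D ∙ v), le_sup_of_le_left hWQ, by
      rw [Submodule.finrank_sup_span_singleton hv, hQ]⟩

theorem Submodule.finrank_sup_of_disjoint {A W : Submodule D V} (h : Disjoint A W) :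
    finrank D ↥(A ⊔ W) = finrank D A + finrank D W := by
  rw [← Submodule.finrank_sup_add_finrank_inf_eq, h.eq_bot, finrank_bot, add_zero]

/-- A finite-dimensional space is not the union of two proper subspaces and a subspace of
codimension at least two. -/
theorem exists_notMem_of_finrank_lt {A B C : Submodule D V} (hA : A ≠ ⊤) (hB : B ≠ ⊤)
    (hC : finrank D C + 1 < finrank D V) : ∃ v, v ∉ A ∧ v ∉ B ∧ v ∉ C := by
  obtain ⟨A', hA', hAA'⟩ := (eq_top_or_exists_le_coatom A).resolve_left hA
  obtain ⟨B', hB', hBB'⟩ := (eq_top_or_exists_le_coatom B).resolve_left hB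
  obtain ⟨x, hxA, hxB⟩ := exists_notMem_notMem_of_ne_top hA'.1 hB'.1
  by_contra! hcover
  have hxC : x ∈ C := hcover x (fun h => hxA (hAA' h)) (fun h => hxB (hBB' h))
  have hAB : A' ⊓ B' ≤ C := fun y hy => by
    refine (C.add_mem_iff_right hxC).1 (hcover (x + y) (fun h => hxA ?_) (fun h => hxB ?_))
    · exact (A'.add_mem_iff_left hy.1).1 (hAA' h)
    · exact (B'.add_mem_iff_left hy.2).1 (hBB' h)
  have hlt : A' ⊓ B' < C := lt_of_le_of_ne hAB (fun h => hxA (h ▸ hxC : x ∈ A' ⊓ B').1)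
  have h1 := Submodule.finrank_lt_finrank_of_lt hlt
  have h2 := Submodule.finrank_sup_add_finrank_inf_eq A' B'
  have h3 := (A' ⊔ B').finrank_le
  have h4 := Submodule.finrank_add_one_of_isCoatom hA'
  have h5 := Submodule.finrank_add_one_of_isCoatom hB'
  omega

/-- Subspaces `A`, `B` of codimension at least `k` and `C` of codimension greater than `k` are
simultaneously disjoint from some `k`-dimensional subspace. -/
theorem exists_finrank_eq_disjoint {A B C : Submodule D V} (k : ℕ)
    (hA : finrank D A + k ≤ finrank D V) (hB : finrank D B + k ≤ finrank D V)
    (hC : finrank D C + k + 1 ≤ finrank D V) :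
    ∃ W : Submodule D V, finrank D W = k ∧ Disjoint A W ∧ Disjoint B W ∧ Disjoint C W := by
  induction k with
  | zero => exact ⟨⊥, finrank_bot D V, disjoint_bot_right, disjoint_bot_right, disjoint_bot_right⟩
  | succ k ih =>
    obtain ⟨W, hW, hAW, hBW, hCW⟩ := ih (by omega) (by omega) (by omega)
    have key (X : Submodule D V) : finrank D ↥(X ⊔ W) ≤ finrank D X + k :=
      hW ▸ Submodule.finrank_add_le_finrank_add_finrank X W
    have ne_top (X : Submodule D V) (hX : finrank D X + (k + 1) ≤ finrank D V) :
        X ⊔ W ≠ ⊤ := fun h => by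
      have := key X
      rw [h, finrank_top] at this
      omega
    obtain ⟨v, hvA, hvB, hvC⟩ := exists_notMem_of_finrank_lt (ne_top A hA) (ne_top B hB)
      (C := C ⊔ W) (by have := key C; omega)
    refine ⟨W ⊔ (D ∙ v), ?_, Submodule.disjoint_sup_span_singleton hAW hvA,
      Submodule.disjoint_sup_span_singleton hBW hvB,
      Submodule.disjoint_sup_span_singleton hCW hvC⟩
    rw [Submodule.finrank_sup_span_singleton fun h => hvA (Submodule.mem_sup_right h), hW]

/-- A version of `exists_finrank_eq_disjoint` relative to an ambient subspace `H`. -/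
theorem exists_le_finrank_eq_disjoint {A B C H : Submodule D V} (k : ℕ) (hAH : A ≤ H)
    (hBH : B ≤ H) (hCH : C ≤ H) (hA : finrank D A + k ≤ finrank D H)
    (hB : finrank D B + k ≤ finrank D H) (hC : finrank D C + k + 1 ≤ finrank D H) :
    ∃ W ≤ H, finrank D W = k ∧ Disjoint A W ∧ Disjoint B W ∧ Disjoint C W := by
  have hcomap {X : Submodule D V} (hX : X ≤ H) :
      finrank D ↥(X.comap H.subtype) = finrank D X :=
    (Submodule.comapSubtypeEquivOfLe hX).finrank_eq
  obtain ⟨W, hW, hAW, hBW, hCW⟩ := exists_finrank_eq_disjoint (A := A.comap H.subtype)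
    (B := B.comap H.subtype) (C := C.comap H.subtype) k (by rwa [hcomap hAH])
    (by rwa [hcomap hBH]) (by rwa [hcomap hCH])
  have hmap {X : Submodule D V} (h : Disjoint (X.comap H.subtype) W) :
      Disjoint X (W.map H.subtype) := by
    rw [Submodule.disjoint_def] at h ⊢
    rintro _ hx ⟨w, hw, rfl⟩
    rw [h w hx hw, map_zero]
  exact ⟨W.map H.subtype, Submodule.map_subtype_le H W,
    (Submodule.finrank_map_subtype_eq H W).trans hW, hmap hAW, hmap hBW, hmap hCW⟩

end Avoidance


/-- Second case in the proof of Lemma 2.1: let `V` be an `n`-dimensional vector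
space over a division ring with `n ≥ 2t ≥ 4`, and let `S`, `U`, `T` be
subspaces of dimension `n - t` such that `S + U = V`, `(S ∩ U) ∩ T = 0`,
`dim(S ∩ T) > n - 2t` and `dim(S ∩ T) + dim(U ∩ T) < n - t`. Then there is an
`(n-t)`-dimensional subspace `Q` with `S + Q = U + Q = T + Q = V`. -/
theorem stmt5 (D : Type*) [DivisionRing D] (V : Type*) [AddCommGroup V] [Module D V]
    [FiniteDimensional D V] (n t : ℕ) (ht : 4 ≤ 2 * t) (hn : 2 * t ≤ n)
    (hV : Module.finrank D V = n)
    (S U T : Submodule D V)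
    (hS : Module.finrank D S = n - t)
    (hU : Module.finrank D U = n - t)
    (hT : Module.finrank D T = n - t)
    (hSU : S ⊔ U = ⊤)
    (hNT : (S ⊓ U) ⊓ T = ⊥)
    (hST : n - 2 * t < Module.finrank D ↥(S ⊓ T))
    (hsum : Module.finrank D ↥(S ⊓ T) + Module.finrank D ↥(U ⊓ T) < n - t) :
    ∃ Q : Submodule D V, Module.finrank D Q = n - t ∧
      S ⊔ Q = ⊤ ∧ U ⊔ Q = ⊤ ∧ T ⊔ Q = ⊤ := by
  have hST_top : S ⊔ T ≠ ⊤ := fun h => by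
    have := Submodule.finrank_sup_add_finrank_inf_eq S T
    rw [h, finrank_top] at this
    omega
  obtain ⟨H, hH, hSTH⟩ := (eq_top_or_exists_le_coatom (S ⊔ T)).resolve_left hST_top
  obtain ⟨hSH, hTH⟩ := sup_le_iff.1 hSTH
  have hHn := Submodule.finrank_add_one_of_isCoatom hH
  have hUH : U ⊔ H = ⊤ := top_unique (hSU ▸ sup_le (hSH.trans le_sup_right) le_sup_left)
  have hUHn := Submodule.finrank_sup_add_finrank_inf_eq U H
  rw [hUH, finrank_top] at hUHn
  obtain ⟨W, hWH, hW, hSW, hTW, hUW⟩ := exists_le_finrank_eq_disjoint (H := H) (t - 1) hSH hTH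
    (inf_le_right : U ⊓ H ≤ H) (by omega) (by omega) (by omega)
  replace hUW : Disjoint U W := disjoint_iff_inf_le.2
    ((le_inf (inf_le_inf_left U hWH) inf_le_right).trans (disjoint_iff_inf_le.1 hUW))
  have hUW_top : U ⊔ W ≠ ⊤ := fun h => by
    have := Submodule.finrank_sup_of_disjoint hUW
    rw [h, finrank_top] at this
    omega
  obtain ⟨v, hvH, hvU⟩ := exists_notMem_notMem_of_ne_top hH.1 hUW_top
  have hv : v ∉ W := fun h => hvH (hWH h)
  have hWv : finrank D ↥(W ⊔ (D ∙ v)) = t := by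
    rw [Submodule.finrank_sup_span_singleton hv]
    omega
  obtain ⟨Q, hWQ, hQ⟩ := Submodule.exists_le_finrank_eq (W := W ⊔ (D ∙ v)) (m := n - t)
    (by omega) (by omega)
  have key {X : Submodule D V} (hX : finrank D X = n - t) (hXW : Disjoint X W)
      (hvX : v ∉ X ⊔ W) : X ⊔ Q = ⊤ := by
    refine top_unique (le_trans (ge_of_eq ?_) (sup_le_sup_left hWQ X))
    apply Submodule.eq_top_of_finrank_eq
    rw [Submodule.finrank_sup_of_disjoint (Submodule.disjoint_sup_span_singleton hXW hvX)]
    omega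
  exact ⟨Q, hQ, key hS hSW fun h => hvH (sup_le hSH hWH h), key hU hUW hvU,
    key hT hTW fun h => hvH (sup_le hTH hWH h)⟩
end

section
/- Let n, m, d be integers with 2 ≤ m ≤ d and n ≥ 2d, let μ = n/2 − d, and let ν be a rational number with 2ν ∈ ℤ and μ + ν ∈ {0, 1/2, 1}. For integers 0 ≤ i ≤ j ≤ m with j − i ≤ d − m, define the polynomials over ℚ: f_{i,j}(x) = ∏_{s=0}^{j−i−1} (x^{n−2m−2μ−2s} − 1)(x^{n−2m−2ν−2s} + 1) and g_{i,j}(x) = ∏_{s=1}^{m−j}(x^{2s} − 1) · ∏_{s=1}^{i}(x^{2s} − 1) · ∏_{s=1}^{j−i}(x^{2s} − 1)². Suppose a, b, a', b' are integers with 0 ≤ a ≤ b ≤ m, 0 ≤ a' ≤ b' ≤ m, b − a ≤ d − m, b' − a' ≤ d − m, satisfying the exponent equation b² + a(n − 2m − 2b + (3/2)a + 1/2 − μ − ν) = b'² + a'(n − 2m − 2b' + (3/2)a' + 1/2 − μ − ν) and the polynomial identity f_{a,b}(x)·g_{a',b'}(x) = f_{a',b'}(x)·g_{a,b}(x) in ℚ[x].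 Then a = a' and b = b'. -/
open Polynomial

/-- The polynomial `f_{i,j}(x) = ∏_{s=0}^{j-i-1} (x^{n-2m-2μ-2s} - 1)(x^{n-2m-2ν-2s} + 1)`,
where the natural-number exponents `n-2m-2μ-2s` and `n-2m-2ν-2s` are given by the
functions `e₁` and `e₂`. -/
noncomputable def fPoly (e₁ e₂ : ℕ → ℕ) (i j : ℕ) : Polynomial ℚ :=
  ∏ s ∈ Finset.range (j - i), ((X ^ e₁ s - 1) * (X ^ e₂ s + 1))

/-- The polynomial
`g_{i,j}(x) = ∏_{s=1}^{m-j}(x^{2s}-1) · ∏_{s=1}^{i}(x^{2s}-1) · ∏_{s=1}^{j-i}(x^{2s}-1)²`. -/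
noncomputable def gPoly (m i j : ℕ) : Polynomial ℚ :=
  (∏ s ∈ Finset.Icc 1 (m - j), (X ^ (2 * s) - 1)) *
    (∏ s ∈ Finset.Icc 1 i, (X ^ (2 * s) - 1)) *
    ∏ s ∈ Finset.Icc 1 (j - i), (X ^ (2 * s) - 1) ^ 2

/-- The number of indices `s ∈ A` with `f s = v`. -/
def fiberCount (f : ℕ → ℕ) (A : Finset ℕ) (v : ℕ) : ℕ := (A.val.map f).count v

theorem fiberCount_pos {f : ℕ → ℕ} {A : Finset ℕ} {v : ℕ} :
    0 < fiberCount f A v ↔ ∃ s ∈ A, f s = v := by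
  simp [fiberCount, Multiset.count_pos]

theorem fiberCount_le_one {f : ℕ → ℕ} {A : Finset ℕ} (hf : Set.InjOn f A) (v : ℕ) :
    fiberCount f A v ≤ 1 :=
  Multiset.nodup_iff_count_le_one.mp (Multiset.Nodup.map_on (fun _ hx _ hy h => hf hx hy h) A.nodup) v

theorem fiberCount_range_add_Ico (f : ℕ → ℕ) {k l : ℕ} (hkl : k ≤ l) (v : ℕ) :
    fiberCount f (Finset.range k) v + fiberCount f (Finset.Ico k l) v =
      fiberCount f (Finset.range l) v := by
  simp only [fiberCount, Multiset.count_map]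
  change (Finset.filter (fun s => v = f s) (Finset.range k)).card +
    (Finset.filter (fun s => v = f s) (Finset.Ico k l)).card =
      (Finset.filter (fun s => v = f s) (Finset.range l)).card
  simp only [Finset.card_filter]
  exact Finset.sum_range_add_sum_Ico _ hkl

/-- The polynomials `X ^ s - 1` with `s > 0` are multiplicatively independent. -/
theorem eq_of_prod_X_pow_sub_one_eq_s6 {S T : Multiset ℕ} (hS : ∀ s ∈ S, 0 < s) (hT : ∀ s ∈ T, 0 < s)
    (h : (S.map fun s => (X ^ s - 1 : ℚ[X])).prod = (T.map fun s => (X ^ s - 1 : ℚ[X])).prod) :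
    S = T := by
  have key : ∀ (U V : Multiset ℕ) (M : ℕ), M ∈ U → 0 < M → (∀ t ∈ V, 0 < t ∧ t ≤ M) →
      (U.map fun s => (X ^ s - 1 : ℚ[X])).prod = (V.map fun s => (X ^ s - 1 : ℚ[X])).prod →
      M ∈ V := by
    intro U V M hMU hM hV hUV
    have hζ := Complex.isPrimitiveRoot_exp M hM.ne'
    set ζ := Complex.exp (2 * Real.pi * Complex.I / M)
    have h1 : aeval ζ (U.map fun s => (X ^ s - 1 : ℚ[X])).prod = 0 := by
      rw [map_multiset_prod, Multiset.prod_eq_zero_iff]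
      simp only [Multiset.map_map, Multiset.mem_map]
      exact ⟨M, hMU, by simp [hζ.pow_eq_one]⟩
    rw [hUV, map_multiset_prod, Multiset.prod_eq_zero_iff] at h1
    simp only [Multiset.map_map, Multiset.mem_map] at h1
    obtain ⟨t, ht, h0⟩ := h1
    have h2 : ζ ^ t = 1 := by simpa [sub_eq_zero] using h0
    have := Nat.le_of_dvd (hV t ht).1 (hζ.dvd_of_pow_eq_one t h2)
    rwa [le_antisymm this (hV t ht).2]
  induction hn : S.card generalizing S T with
  | zero =>
    rw [Multiset.card_eq_zero] at hn
    subst hn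
    by_contra hne
    obtain ⟨t, ht⟩ := Multiset.exists_mem_of_ne_zero (Ne.symm hne)
    have h1 : aeval (1 : ℚ) (T.map fun s => (X ^ s - 1 : ℚ[X])).prod = 0 := by
      rw [map_multiset_prod, Multiset.prod_eq_zero_iff]
      simp only [Multiset.map_map, Multiset.mem_map]
      exact ⟨t, ht, by simp⟩
    rw [← h] at h1
    simp at h1
  | succ n ih =>
    have hne : (S + T).toFinset.Nonempty := by
      obtain ⟨s, hs⟩ := Multiset.card_pos_iff_exists_mem.mp (by omega : 0 < S.card)
      exact ⟨s, by simp [hs]⟩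
    obtain ⟨M, hM, hmax⟩ := Finset.exists_max_image _ id hne
    simp only [Multiset.mem_toFinset, Multiset.mem_add, id] at hM hmax
    have hpos : 0 < M := hM.elim (hS M) (hT M)
    have hMS : M ∈ S := hM.elim id fun hM =>
      key T S M hM hpos (fun t ht => ⟨hS t ht, hmax t (.inl ht)⟩) h.symm
    have hMT : M ∈ T := key S T M hMS hpos (fun t ht => ⟨hT t ht, hmax t (.inr ht)⟩) h
    obtain ⟨S', rfl⟩ := Multiset.exists_cons_of_mem hMS
    obtain ⟨T', rfl⟩ := Multiset.exists_cons_of_mem hMT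
    simp only [Multiset.map_cons, Multiset.prod_cons] at h
    rw [ih (fun s hs => hS s (Multiset.mem_cons_of_mem hs))
      (fun s hs => hT s (Multiset.mem_cons_of_mem hs))
      (mul_left_cancel₀ (X_pow_sub_C_ne_zero hpos 1) h) (by simpa using hn)]

/-- The exponents of the factors `X ^ (2 * s) - 1` of `gPoly m i j`. -/
def gExponents (m i j : ℕ) : Multiset ℕ :=
  (Finset.range (m - j)).val.map (fun s => 2 * (s + 1)) +
    (Finset.range i).val.map (fun s => 2 * (s + 1)) +
    2 • (Finset.range (j - i)).val.map (fun s => 2 * (s + 1))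

theorem pos_of_mem_gExponents {m i j s : ℕ} (hs : s ∈ gExponents m i j) : 0 < s := by
  simp only [gExponents, two_nsmul, Multiset.mem_add, Multiset.mem_map] at hs
  grind

theorem count_gExponents (m i j v : ℕ) :
    (gExponents m i j).count v =
      fiberCount (fun s => 2 * (s + 1)) (Finset.range (m - j)) v +
        fiberCount (fun s => 2 * (s + 1)) (Finset.range i) v +
        2 * fiberCount (fun s => 2 * (s + 1)) (Finset.range (j - i)) v := by
  simp [gExponents, fiberCount]

theorem gPoly_eq_prod (m i j : ℕ) :
    gPoly m i j = ((gExponents m i j).map fun s => (X ^ s - 1 : ℚ[X])).prod := by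
  have h (n : ℕ) : ∏ s ∈ Finset.Icc 1 n, (X ^ (2 * s) - 1 : ℚ[X]) =
      ∏ s ∈ Finset.range n, (X ^ (2 * (s + 1)) - 1) := by
    rw [Finset.range_eq_Ico, Finset.prod_Ico_add' (fun s => (X ^ (2 * s) - 1 : ℚ[X])) 0 n 1]
    rfl
  simp only [gPoly, gExponents, Finset.prod_pow, h, Multiset.map_add, Multiset.prod_add,
    Multiset.map_nsmul, Multiset.prod_nsmul, Multiset.map_map]
  rfl

theorem gPoly_monic (m i j : ℕ) : (gPoly m i j).Monic := by
  rw [gPoly_eq_prod]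
  exact monic_multiset_prod_of_monic _ _ fun s hs =>
    monic_X_pow_sub_C 1 (pos_of_mem_gExponents hs).ne'

theorem fPoly_monic {e₁ e₂ : ℕ → ℕ} {i j : ℕ} (h₁ : ∀ s < j - i, 0 < e₁ s)
    (h₂ : ∀ s < j - i, 0 < e₂ s) : (fPoly e₁ e₂ i j).Monic :=
  monic_prod_of_monic _ _ fun s hs =>
    (monic_X_pow_sub_C 1 (h₁ s (Finset.mem_range.mp hs)).ne').mul
      (monic_X_pow_add_C 1 (h₂ s (Finset.mem_range.mp hs)).ne')

theorem fPoly_ne_zero {e₁ e₂ : ℕ → ℕ} {i j : ℕ} (h₁ : ∀ s < j - i, 0 < e₁ s) :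
    fPoly e₁ e₂ i j ≠ 0 := by
  refine Finset.prod_ne_zero_iff.mpr fun s hs =>
    mul_ne_zero (X_pow_sub_C_ne_zero (h₁ s (Finset.mem_range.mp hs)) 1) fun h => ?_
  have := congrArg (eval 1) h
  norm_num at this

theorem fPoly_mul_prod (e₁ e₂ : ℕ → ℕ) (i j : ℕ) :
    fPoly e₁ e₂ i j *
        (((Finset.range (j - i)).val.map e₂).map fun s => (X ^ s - 1 : ℚ[X])).prod =
      (((Finset.range (j - i)).val.map e₁ + (Finset.range (j - i)).val.map (fun s => 2 * e₂ s)).map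
        fun s => (X ^ s - 1 : ℚ[X])).prod := by
  simp only [Multiset.map_add, Multiset.prod_add, Multiset.map_map]
  change _ * ∏ s ∈ Finset.range (j - i), (X ^ e₂ s - 1 : ℚ[X]) =
    (∏ s ∈ Finset.range (j - i), (X ^ e₁ s - 1 : ℚ[X])) *
      ∏ s ∈ Finset.range (j - i), (X ^ (2 * e₂ s) - 1 : ℚ[X])
  rw [fPoly, ← Finset.prod_mul_distrib, ← Finset.prod_mul_distrib]
  refine Finset.prod_congr rfl fun s _ => ?_
  rw [two_mul, pow_add]
  ring

/-- Comparison of the exponents on both sides of `f * g' = f' * g`, after writing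
`X ^ e + 1 = (X ^ (2 * e) - 1) / (X ^ e - 1)`. -/
theorem fiberCount_eq_of_fPoly_mul_gPoly_eq {e₁ e₂ : ℕ → ℕ} {m a b a' b' : ℕ}
    (hk : b - a ≤ b' - a') (h₁ : ∀ s < b' - a', 0 < e₁ s) (h₂ : ∀ s < b' - a', 0 < e₂ s)
    (h : fPoly e₁ e₂ a b * gPoly m a' b' = fPoly e₁ e₂ a' b' * gPoly m a b) (v : ℕ) :
    fiberCount e₁ (Finset.Ico (b - a) (b' - a')) v +
        fiberCount (fun s => 2 * e₂ s) (Finset.Ico (b - a) (b' - a')) v +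
        (gExponents m a b).count v =
      fiberCount e₂ (Finset.Ico (b - a) (b' - a')) v + (gExponents m a' b').count v := by
  have key : (Finset.range (b - a)).val.map e₁ +
        (Finset.range (b - a)).val.map (fun s => 2 * e₂ s) +
        (Finset.range (b' - a')).val.map e₂ + gExponents m a' b' =
      (Finset.range (b' - a')).val.map e₁ +
        (Finset.range (b' - a')).val.map (fun s => 2 * e₂ s) +
        (Finset.range (b - a)).val.map e₂ + gExponents m a b := by
    apply eq_of_prod_X_pow_sub_one_eq_s6
    · intro s hs
      simp only [Multiset.mem_add, Multiset.mem_map, Finset.mem_val, Finset.mem_range] at hs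
      rcases hs with ((⟨t, ht, rfl⟩ | ⟨t, ht, rfl⟩) | ⟨t, ht, rfl⟩) | hs
      · exact h₁ t (by omega)
      · have := h₂ t (by omega); omega
      · exact h₂ t ht
      · exact pos_of_mem_gExponents hs
    · intro s hs
      simp only [Multiset.mem_add, Multiset.mem_map, Finset.mem_val, Finset.mem_range] at hs
      rcases hs with ((⟨t, ht, rfl⟩ | ⟨t, ht, rfl⟩) | ⟨t, ht, rfl⟩) | hs
      · exact h₁ t ht
      · have := h₂ t ht; omega
      · exact h₂ t (by omega)
      · exact pos_of_mem_gExponents hs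
    · rw [Multiset.map_add, Multiset.map_add, Multiset.prod_add, Multiset.prod_add,
        ← fPoly_mul_prod, ← gPoly_eq_prod, Multiset.map_add _ _ (gExponents m a b),
        Multiset.map_add _ _ (Multiset.map e₂ _), Multiset.prod_add, Multiset.prod_add,
        ← fPoly_mul_prod, ← gPoly_eq_prod]
      linear_combination
        (((Finset.range (b - a)).val.map e₂).map fun s => (X ^ s - 1 : ℚ[X])).prod *
        (((Finset.range (b' - a')).val.map e₂).map fun s => (X ^ s - 1 : ℚ[X])).prod * h
  replace key := congrArg (Multiset.count v) key
  simp only [Multiset.count_add] at key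
  have s₁ := fiberCount_range_add_Ico e₁ hk v
  have s₂ := fiberCount_range_add_Ico e₂ hk v
  have s₃ := fiberCount_range_add_Ico (fun s => 2 * e₂ s) hk v
  simp only [fiberCount] at *
  omega

theorem pos_exponents {D G k : ℕ} {e₁ e₂ : ℕ → ℕ} (hk : k ≤ D)
    (he₁ : ∀ s < D, e₁ s = 2 * (D - s)) (he₂ : ∀ s < D, e₂ s + 2 = 2 * (D - s) + G)
    (hlt : k < D ∨ 0 < G) : ∀ s < k, 0 < e₁ s ∧ 0 < e₂ s := by
  intro s hs
  have := he₁ s (by omega)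
  have := he₂ s (by omega)
  omega

/-- The factor `X ^ 0 + 1 = 2` does not occur in the longer of two products whose ratio is that of
two values of `gPoly`. -/
theorem lt_or_pos_of_fPoly_mul_gPoly_eq {D G m a b a' b' : ℕ} {e₁ e₂ : ℕ → ℕ}
    (he₁ : ∀ s < D, e₁ s = 2 * (D - s)) (he₂ : ∀ s < D, e₂ s + 2 = 2 * (D - s) + G)
    (hk : b - a < b' - a') (hk' : b' - a' ≤ D)
    (h : fPoly e₁ e₂ a b * gPoly m a' b' = fPoly e₁ e₂ a' b' * gPoly m a b) :
    b' - a' < D ∨ 0 < G := by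
  by_contra! hc
  have hp := pos_exponents (k := D - 1) (by omega) he₁ he₂ (.inl (by omega))
  have hf : (fPoly e₁ e₂ a b).Monic :=
    fPoly_monic (fun s hs => (hp s (by omega)).1) (fun s hs => (hp s (by omega)).2)
  have hf₀ : (fPoly e₁ e₂ 0 (D - 1)).Monic :=
    fPoly_monic (fun s hs => (hp s (by omega)).1) (fun s hs => (hp s (by omega)).2)
  have hf' : fPoly e₁ e₂ a' b' = fPoly e₁ e₂ 0 (D - 1) * ((X ^ e₁ (D - 1) - 1) * C 2) := by
    rw [fPoly, fPoly, show b' - a' = D - 1 - 0 + 1 by omega, Finset.prod_range_succ, Nat.sub_zero,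
      show e₂ (D - 1) = 0 by have := he₂ (D - 1) (by omega); omega, pow_zero, C_ofNat]
    norm_num
  have hX : (X ^ e₁ (D - 1) - 1 : ℚ[X]).Monic :=
    monic_X_pow_sub_C 1 (by have := he₁ (D - 1) (by omega); omega)
  have hl := congrArg leadingCoeff h
  rw [hf', leadingCoeff_mul, leadingCoeff_mul, leadingCoeff_mul, leadingCoeff_mul, leadingCoeff_C,
    hf.leadingCoeff, hf₀.leadingCoeff, hX.leadingCoeff, (gPoly_monic ..).leadingCoeff,
    (gPoly_monic ..).leadingCoeff] at hl
  norm_num at hl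

theorem not_lt_of_fPoly_mul_gPoly_eq {D G m a b a' b' : ℕ} {e₁ e₂ : ℕ → ℕ}
    (he₁ : ∀ s < D, e₁ s = 2 * (D - s)) (he₂ : ∀ s < D, e₂ s + 2 = 2 * (D - s) + G)
    (hab : a ≤ b) (hbm : b ≤ m) (hab' : a' ≤ b') (hbm' : b' ≤ m) (hk' : b' - a' ≤ D)
    (hexp : 2 * ((b : ℤ) - a) ^ 2 + a ^ 2 + a * (4 * D + G - 1) =
      2 * ((b' : ℤ) - a') ^ 2 + a' ^ 2 + a' * (4 * D + G - 1))
    (h : fPoly e₁ e₂ a b * gPoly m a' b' = fPoly e₁ e₂ a' b' * gPoly m a b) :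
    ¬ b - a < b' - a' := by
  intro hlt
  have hpos := pos_exponents hk' he₁ he₂ (lt_or_pos_of_fPoly_mul_gPoly_eq he₁ he₂ hlt hk' h)
  have hE := fiberCount_eq_of_fPoly_mul_gPoly_eq hlt.le
    (fun s hs => (hpos s hs).1) (fun s hs => (hpos s hs).2) h
  obtain ⟨k, rfl⟩ := Nat.exists_eq_add_of_le hab
  obtain ⟨k', rfl⟩ := Nat.exists_eq_add_of_le hab'
  simp only [Nat.add_sub_cancel_left] at *
  push_cast at hexp
  have ha : a' < a := by
    by_contra! hc
    have : (k : ℤ) < k' := by exact_mod_cast hlt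
    have h1 : (a : ℤ) ≤ a' := by exact_mod_cast hc
    have h2 : (1 : ℤ) ≤ D := by omega
    nlinarith [mul_nonneg (sub_nonneg.mpr h1) (by omega : (0 : ℤ) ≤ a + a' + 4 * D + G - 1)]
  have hp : a + k < a' + k' := by
    by_contra! hc
    have h0 : (1 : ℤ) ≤ k' - k := by omega
    have h1 : (k' : ℤ) - k ≤ a - a' := by omega
    have h2 : 2 * ((k' : ℤ) + k) < a + a' + 4 * D + G - 1 := by omega
    nlinarith [mul_le_mul_of_nonneg_right h1 (by omega : (0 : ℤ) ≤ a + a' + 4 * D + G - 1)]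
  have hD (v : ℕ) : fiberCount e₁ (Finset.Ico k k') v +
        fiberCount (fun s => 2 * e₂ s) (Finset.Ico k k') v +
        fiberCount (fun s => 2 * (s + 1)) (Finset.Ico (m - (a' + k')) (m - (a + k))) v +
        fiberCount (fun s => 2 * (s + 1)) (Finset.Ico a' a) v =
      fiberCount e₂ (Finset.Ico k k') v +
        2 * fiberCount (fun s => 2 * (s + 1)) (Finset.Ico k k') v := by
    have := hE v
    rw [count_gExponents, count_gExponents, Nat.add_sub_cancel_left, Nat.add_sub_cancel_left] at this
    have := fiberCount_range_add_Ico (fun s => 2 * (s + 1))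
      (by omega : m - (a' + k') ≤ m - (a + k)) v
    have := fiberCount_range_add_Ico (fun s => 2 * (s + 1)) ha.le v
    have := fiberCount_range_add_Ico (fun s => 2 * (s + 1)) hlt.le v
    omega
  -- `e₂` takes even values, since all exponents on the left are even.
  have hG : Even G := by
    have h0 : 0 < fiberCount e₂ (Finset.Ico k k') (e₂ k) :=
      fiberCount_pos.mpr ⟨k, by simp [hlt], rfl⟩
    have h1 := hD (e₂ k)
    have h2 := he₂ k (by omega)
    rw [Nat.even_iff]
    have h3 : 0 < fiberCount e₁ (Finset.Ico k k') (e₂ k) ∨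
        0 < fiberCount (fun s => 2 * e₂ s) (Finset.Ico k k') (e₂ k) ∨
        0 < fiberCount (fun s => 2 * (s + 1)) (Finset.Ico (m - (a' + k')) (m - (a + k))) (e₂ k) ∨
        0 < fiberCount (fun s => 2 * (s + 1)) (Finset.Ico a' a) (e₂ k) := by omega
    simp only [fiberCount_pos, Finset.mem_Ico] at h3
    rcases h3 with ⟨s, hs, h⟩ | ⟨s, hs, h⟩ | ⟨s, hs, h⟩ | ⟨s, hs, h⟩
    · have := he₁ s (by omega); omega
    all_goals omega
  obtain ⟨g, rfl⟩ := hG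
  have hlast := he₂ (k' - 1) (by omega)
  have hlast_pos := hpos (k' - 1) (by omega)
  have hmem (s : ℕ) (hs : s ∈ Finset.Ico k k') :
      (∃ t ∈ Finset.Ico k k', e₂ t = 2 * e₂ s) ∨ ∃ t ∈ Finset.Ico k k', 2 * (t + 1) = 2 * e₂ s := by
    have h0 : 0 < fiberCount (fun s => 2 * e₂ s) (Finset.Ico k k') (2 * e₂ s) :=
      fiberCount_pos.mpr ⟨s, hs, rfl⟩
    have h1 := hD (2 * e₂ s)
    rw [← fiberCount_pos, ← fiberCount_pos (f := fun t => 2 * (t + 1))]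
    omega
  have hfirst := he₂ k (by omega)
  have hbig : e₂ k ≤ k' := by
    rcases hmem k (by simp [hlt]) with ⟨t, ht, h⟩ | ⟨t, ht, h⟩ <;> rw [Finset.mem_Ico] at ht
    · have := he₂ t (by omega)
      have := hpos k hlt
      omega
    · omega
  have hsmall : 2 * e₂ (k' - 1) ≤ e₂ k := by
    rcases hmem (k' - 1) (by simp; omega) with ⟨t, ht, h⟩ | ⟨t, ht, h⟩ <;>
      rw [Finset.mem_Ico] at ht
    · have := he₂ t (by omega)
      omega
    · omega
  have hnot : fiberCount e₁ (Finset.Ico k k') (2 * e₂ (k' - 1)) = 0 := by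
    have h0 : 0 < fiberCount (fun s => 2 * e₂ s) (Finset.Ico k k') (2 * e₂ (k' - 1)) :=
      fiberCount_pos.mpr ⟨k' - 1, by simp; omega, rfl⟩
    have h1 := hD (2 * e₂ (k' - 1))
    have h2 : fiberCount e₂ (Finset.Ico k k') (2 * e₂ (k' - 1)) ≤ 1 := by
      refine fiberCount_le_one (fun x hx y hy hxy => ?_) _
      simp only [Finset.coe_Ico, Set.mem_Ico] at hx hy
      have := he₂ x (by omega)
      have := he₂ y (by omega)
      omega
    have h3 : ¬ 0 < fiberCount (fun s => 2 * (s + 1)) (Finset.Ico k k') (2 * e₂ (k' - 1)) := by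
      simp only [fiberCount_pos, Finset.mem_Ico]
      rintro ⟨t, ht, h⟩
      omega
    omega
  have hmin := he₁ (k' - 1) (by omega)
  have hg : 2 ≤ g := by
    by_contra! hg
    refine (Nat.pos_iff_ne_zero.mp (fiberCount_pos.mpr
      ⟨D - e₂ (k' - 1), Finset.mem_Ico.mpr ⟨?_, ?_⟩, ?_⟩)) hnot
    · omega
    · omega
    · rw [he₁ _ (by omega)]; omega
  have hlow : 0 < fiberCount e₁ (Finset.Ico k k') (e₁ (k' - 1)) :=
    fiberCount_pos.mpr ⟨k' - 1, by simp; omega, rfl⟩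
  have h1 := hD (e₁ (k' - 1))
  have h2 : 0 < fiberCount e₂ (Finset.Ico k k') (e₁ (k' - 1)) ∨
      0 < fiberCount (fun s => 2 * (s + 1)) (Finset.Ico k k') (e₁ (k' - 1)) := by omega
  simp only [fiberCount_pos, Finset.mem_Ico] at h2
  rcases h2 with ⟨t, ht, h⟩ | ⟨t, ht, h⟩
  · have := he₂ t (by omega)
    omega
  · omega

theorem eq_of_gPoly_eq_of_lt {m a b a' b' : ℕ} (hab : a ≤ b) (hbm : b ≤ m) (hab' : a' ≤ b')
    (hbm' : b' ≤ m) (hk : b - a = b' - a') (ha : a' < a) (h : gPoly m a b = gPoly m a' b') :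
    a = m - b' := by
  rw [gPoly_eq_prod, gPoly_eq_prod] at h
  have hE := eq_of_prod_X_pow_sub_one_eq_s6 (fun _ => pos_of_mem_gExponents)
    (fun _ => pos_of_mem_gExponents) h
  have hD (v : ℕ) : fiberCount (fun s => 2 * (s + 1)) (Finset.Ico a' a) v =
      fiberCount (fun s => 2 * (s + 1)) (Finset.Ico (m - b) (m - b')) v := by
    have := congrArg (Multiset.count v) hE
    rw [count_gExponents, count_gExponents, hk] at this
    have := fiberCount_range_add_Ico (fun s => 2 * (s + 1)) ha.le v
    have := fiberCount_range_add_Ico (fun s => 2 * (s + 1)) (by omega : m - b ≤ m - b') v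
    omega
  have h1 : 0 < fiberCount (fun s => 2 * (s + 1)) (Finset.Ico a' a) (2 * (a - 1 + 1)) :=
    fiberCount_pos.mpr ⟨a - 1, by simp; omega, rfl⟩
  have h2 : 0 < fiberCount (fun s => 2 * (s + 1)) (Finset.Ico (m - b) (m - b'))
      (2 * (m - b' - 1 + 1)) := fiberCount_pos.mpr ⟨m - b' - 1, by simp; omega, rfl⟩
  rw [hD, fiberCount_pos] at h1
  rw [← hD, fiberCount_pos] at h2
  simp only [Finset.mem_Ico] at h1 h2
  omega

theorem not_lt_of_gPoly_eq {D G m a b a' b' : ℕ} (hm : 2 ≤ m) (hab : a ≤ b) (hbm : b ≤ m)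
    (hab' : a' ≤ b') (hbm' : b' ≤ m) (hkD : b - a ≤ D) (hk : b - a = b' - a')
    (hexp : 2 * ((b : ℤ) - a) ^ 2 + a ^ 2 + a * (4 * D + G - 1) =
      2 * ((b' : ℤ) - a') ^ 2 + a' ^ 2 + a' * (4 * D + G - 1))
    (h : gPoly m a b = gPoly m a' b') : ¬ a' < a := by
  intro ha
  have hp := eq_of_gPoly_eq_of_lt hab hbm hab' hbm' hk ha h
  have hk' : (b : ℤ) - a = b' - a' := by omega
  rw [hk'] at hexp
  have h1 : ((a : ℤ) - a') * (a + a' + 4 * D + G - 1) = 0 := by linear_combination hexp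
  rcases mul_eq_zero.mp h1 with h1 | h1 <;> omega

/-- Algebraic core of Proposition `prop-val`: if the pairs `(a,b)` and `(a',b')`
satisfy the exponent equation and the polynomial identity
`f_{a,b}·g_{a',b'} = f_{a',b'}·g_{a,b}` coming from the equality of the
valencies `n_{a,b} = n_{a',b'}` of Stanton's formula, then `a = a'` and
`b = b'`. -/
theorem stmt6 (n m d : ℕ) (μ ν : ℚ) (a b a' b' : ℕ)
    (hm : 2 ≤ m) (hmd : m ≤ d) (hdn : 2 * d ≤ n)
    (hμ : μ = (n : ℚ) / 2 - d)
    (hν : ∃ z : ℤ, 2 * ν = (z : ℚ))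
    (hμν : μ + ν = 0 ∨ μ + ν = 1 / 2 ∨ μ + ν = 1)
    (e₁ e₂ : ℕ → ℕ)
    (he₁ : ∀ s < d - m, (e₁ s : ℚ) = n - 2 * m - 2 * μ - 2 * s)
    (he₂ : ∀ s < d - m, (e₂ s : ℚ) = n - 2 * m - 2 * ν - 2 * s)
    (hab : a ≤ b) (hbm : b ≤ m) (hab' : a' ≤ b') (hbm' : b' ≤ m)
    (hba : b - a ≤ d - m) (hba' : b' - a' ≤ d - m)
    (hexp : (b : ℚ) ^ 2 + a * ((n : ℚ) - 2 * m - 2 * b + 3 / 2 * a + 1 / 2 - μ - ν)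
        = (b' : ℚ) ^ 2 + a' * ((n : ℚ) - 2 * m - 2 * b' + 3 / 2 * a' + 1 / 2 - μ - ν))
    (hpoly : fPoly e₁ e₂ a b * gPoly m a' b' = fPoly e₁ e₂ a' b' * gPoly m a b) :
    a = a' ∧ b = b' := by
  obtain ⟨G, hG⟩ : ∃ G : ℕ, (G : ℚ) = 2 * n - 4 * d + 2 - 2 * (μ + ν) := by
    obtain ⟨N, rfl⟩ := Nat.exists_eq_add_of_le hdn
    rcases hμν with h | h | h
    · exact ⟨2 * N + 2, by rw [h]; push_cast; ring⟩
    · exact ⟨2 * N + 1, by rw [h]; push_cast; ring⟩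
    · exact ⟨2 * N, by rw [h]; push_cast; ring⟩
  obtain ⟨D, rfl⟩ := Nat.exists_eq_add_of_le hmd
  rw [Nat.add_sub_cancel_left] at *
  push_cast at hμ hG
  have he₁' : ∀ s < D, e₁ s = 2 * (D - s) := by
    intro s hs
    have : (e₁ s : ℚ) + 2 * s = 2 * D := by rw [he₁ s hs, hμ]; ring
    have : e₁ s + 2 * s = 2 * D := by exact_mod_cast this
    omega
  have he₂' : ∀ s < D, e₂ s + 2 = 2 * (D - s) + G := by
    intro s hs
    have : (e₂ s : ℚ) + 2 + 2 * s = 2 * D + G := by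
      rw [he₂ s hs]; linear_combination -hG + 2 * hμ
    have : e₂ s + 2 + 2 * s = 2 * D + G := by exact_mod_cast this
    omega
  have hexp' : 2 * ((b : ℤ) - a) ^ 2 + a ^ 2 + a * (4 * D + G - 1) =
      2 * ((b' : ℤ) - a') ^ 2 + a' ^ 2 + a' * (4 * D + G - 1) := by
    have : 2 * ((b : ℚ) - a) ^ 2 + a ^ 2 + a * (4 * D + G - 1) =
        2 * ((b' : ℚ) - a') ^ 2 + a' ^ 2 + a' * (4 * D + G - 1) := by
      linear_combination 2 * hexp + (a - a' : ℚ) * hG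
    exact_mod_cast this
  have hk : b - a = b' - a' := le_antisymm
    (not_lt.mp (not_lt_of_fPoly_mul_gPoly_eq he₁' he₂' hab' hbm' hab hbm hba hexp'.symm hpoly.symm))
    (not_lt.mp (not_lt_of_fPoly_mul_gPoly_eq he₁' he₂' hab hbm hab' hbm' hba' hexp' hpoly))
  have hg : gPoly m a' b' = gPoly m a b := by
    have hf : fPoly e₁ e₂ a b = fPoly e₁ e₂ a' b' := by rw [fPoly, fPoly, hk]
    rw [hf] at hpoly
    exact mul_left_cancel₀
      (fPoly_ne_zero fun s hs => by rw [he₁' s (by omega)]; omega) hpoly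
  have h1 := not_lt_of_gPoly_eq hm hab hbm hab' hbm' hba hk hexp' hg.symm
  have h2 := not_lt_of_gPoly_eq hm hab' hbm' hab hbm hba' hk.symm hexp'.symm hg
  omega
end

section
/- Let K be a field, let V be a finite-dimensional K-vector space of dimension at least 6, and let ω be a nondegenerate alternating bilinear form on V. Let p, q, t be nonzero vectors of V such that ω(p, q) ≠ 0 and such that ω(p, t) = 0 or ω(q, t) = 0. Then there exists a vector v ∈ V with ω(v, p) ≠ 0, ω(v, q) ≠ 0, and ω(v, t) ≠ 0. -/
/-- Lemma 1.1 in the symplectic polar space: let `ω` be a nondegenerate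
alternating bilinear form on a `K`-vector space `V` of dimension at least `6`.
If `p, q, t` are nonzero vectors with `ω p q ≠ 0` (non-collinear points) and
`ω p t = 0` or `ω q t = 0` (`t` is collinear to `p` or `q`), then there is a
vector `v` with `ω v p ≠ 0`, `ω v q ≠ 0` and `ω v t ≠ 0`. -/
theorem stmt7 (K : Type*) [Field K] (V : Type*) [AddCommGroup V] [Module K V]
    [FiniteDimensional K V] (hdim : 6 ≤ Module.finrank K V)
    (ω : LinearMap.BilinForm K V)
    (halt : ω.IsAlt) (hnd : ω.Nondegenerate)
    (p q t : V) (hp : p ≠ 0) (hq : q ≠ 0) (ht : t ≠ 0)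
    (hpq : ω p q ≠ 0) (hcol : ω p t = 0 ∨ ω q t = 0) :
    ∃ v : V, ω v p ≠ 0 ∧ ω v q ≠ 0 ∧ ω v t ≠ 0 := by
  have hqp : ω q p ≠ 0 := fun h => hpq (halt.isRefl q p h)
  by_cases h : ω p t = 0 ∧ ω q t = 0
  · obtain ⟨hpt, hqt⟩ := h
    obtain ⟨u, hu⟩ : ∃ u, ω u t ≠ 0 := by
      by_contra! h
      exact ht (hnd.2 t h)
    refine ⟨u + ((1 - ω u q) / ω p q) • p + ((1 - ω u p) / ω q p) • q, ?_, ?_, ?_⟩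
    · simp [halt p, hqp]
    · simp [halt q, hpq]
    · simpa [hpt, hqt] using hu
  · refine ⟨p + q, by simpa [halt p] using hqp, by simpa [halt q] using hpq, ?_⟩
    rcases hcol with hpt | hqt
    · simpa [hpt] using h
    · simpa [hqt] using h
end

section
/- Let D be a division ring with at least three elements, let V be a nonzero left vector space over D, and let W₁, W₂, W₃ be proper subspaces of V. Then W₁ ∪ W₂ ∪ W₃ ≠ V; that is, there exists a vector v ∈ V lying in none of W₁, W₂, W₃. -/
theorem Submodule.eq_of_add_smul_mem {D V : Type*} [DivisionRing D] [AddCommGroup V] [Module D V]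
    {W : Submodule D V} {u v : V} (hv : v ∉ W) {c d : D}
    (hc : u + c • v ∈ W) (hd : u + d • v ∈ W) : c = d := by
  by_contra h
  have hsub : (c - d) • v ∈ W := by
    have := W.sub_mem hc hd
    rwa [add_sub_add_left_eq_sub, ← sub_smul] at this
  exact hv ((W.smul_mem_iff (sub_ne_zero.mpr h)).mp hsub)

theorem Submodule.add_smul_notMem {D V : Type*} [DivisionRing D] [AddCommGroup V] [Module D V]
    {W : Submodule D V} {u v : V} (hu : u ∉ W) (hv : v ∈ W) (c : D) : u + c • v ∉ W :=
  fun h ↦ hu ((W.add_mem_iff_left (W.smul_mem c hv)).mp h)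

theorem Submodule.exists_notMem_notMem {D V : Type*} [DivisionRing D] [AddCommGroup V]
    [Module D V] {W₁ W₂ : Submodule D V} (h₁ : W₁ ≠ ⊤) (h₂ : W₂ ≠ ⊤) :
    ∃ v : V, v ∉ W₁ ∧ v ∉ W₂ := by
  obtain ⟨v, hv⟩ := SetLike.exists_not_mem_of_ne_top W₁ h₁ rfl
  obtain ⟨u, hu⟩ := SetLike.exists_not_mem_of_ne_top W₂ h₂ rfl
  by_contra! H
  have key (c : D) : u + c • v ∈ W₁ := by
    by_contra h
    exact add_smul_notMem hu (H v hv) c (H _ h)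
  exact zero_ne_one (eq_of_add_smul_mem hv (key 0) (key 1))

/-- A nonzero vector space over a division ring with at least three elements
(i.e. possessing an element distinct from `0` and `1`) is not the union of
three proper subspaces. -/
theorem stmt8 (D : Type*) [DivisionRing D] (hD : ∃ a : D, a ≠ 0 ∧ a ≠ 1)
    (V : Type*) [AddCommGroup V] [Module D V] [Nontrivial V]
    (W₁ W₂ W₃ : Submodule D V) (h₁ : W₁ ≠ ⊤) (h₂ : W₂ ≠ ⊤) (h₃ : W₃ ≠ ⊤) :
    ∃ v : V, v ∉ W₁ ∧ v ∉ W₂ ∧ v ∉ W₃ := by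
  obtain ⟨a, ha₀, ha₁⟩ := hD
  obtain ⟨v, hv₁, hv₂⟩ := Submodule.exists_notMem_notMem h₁ h₂
  obtain ⟨u, hu⟩ := SetLike.exists_not_mem_of_ne_top W₃ h₃ rfl
  by_contra! H
  have key (c : D) : u + c • v ∈ W₁ ∨ u + c • v ∈ W₂ := by
    by_contra! h
    exact Submodule.add_smul_notMem hu (H v hv₁ hv₂) c (H _ h.1 h.2)
  have eq₁ {c d : D} := Submodule.eq_of_add_smul_mem (u := u) (c := c) (d := d) hv₁
  have eq₂ {c d : D} := Submodule.eq_of_add_smul_mem (u := u) (c := c) (d := d) hv₂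
  have h01 : (0 : D) ≠ 1 := zero_ne_one
  rcases key 0 with k₀ | k₀ <;> rcases key 1 with k₁ | k₁ <;> rcases key a with k | k <;>
    first
    | exact h01 (eq₁ k₀ k₁)
    | exact h01 (eq₂ k₀ k₁)
    | exact ha₀ (eq₁ k k₀)
    | exact ha₀ (eq₂ k k₀)
    | exact ha₁ (eq₁ k k₁)
    | exact ha₁ (eq₂ k k₁)
end
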